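/- Let q > 2 be a prime power, d ≥ 1, N = (d+1)(q−1), and l an integer with 2l < q + 2. Then the complete graph K_l on any l vertices of σ^N is a constraint graph: every continuous map f : ‖σ^N‖ → ℝ^d has a Tverberg partition F₁, …, F_q such that each F_i contains at most one of the l chosen vertices. -/

import Mathlib

/-- The geometric realization of the face of the standard simplex spanned by
the vertex set `F`: points of the standard simplex supported on `F`. -/
def faceRealization {ι : Type*} [Fintype ι] (F : Finset ι) :
    Set (stdSimplex ℝ ι) :=
  {w | ∀ j : ι, w.1 j ≠ 0 → j ∈ F}

section ListCochains

variable {k : Type*} [CommRing k]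

/-- The coboundary of a cochain on lists, evaluated at a list: the alternating sum of the values
at the lists with one entry removed. -/
def listCoboundaryAt (k : Type*) [CommRing k] {α : Type*} : List α → (List α → k) →ₗ[k] k
  | [] => 0
  | x :: w => LinearMap.proj w - listCoboundaryAt k w ∘ₗ LinearMap.funLeft k k (List.cons x)

/-- The coboundary operator on cochains on lists (augmented ordered cochains of the full simplex
on `α`). -/
def listCoboundary (k : Type*) [CommRing k] (α : Type*) : (List α → k) →ₗ[k] (List α → k) :=
  LinearMap.pi (listCoboundaryAt k)

variable {α β Y : Type*}

lemma listCoboundary_cons (φ : List α → k) (x : α) (w : List α) :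
    listCoboundary k α φ (x :: w) =
      φ w - listCoboundary k α (LinearMap.funLeft k k (List.cons x) φ) w := rfl

lemma funLeft_cons_listCoboundary (φ : List α → k) (x : α) :
    LinearMap.funLeft k k (List.cons x) (listCoboundary k α φ) =
      φ - listCoboundary k α (LinearMap.funLeft k k (List.cons x) φ) := rfl

lemma listCoboundary_listCoboundary (φ : List α → k) :
    listCoboundary k α (listCoboundary k α φ) = 0 := by
  funext w
  induction w generalizing φ with
  | nil => rfl
  | cons x w ih =>
    rw [listCoboundary_cons, funLeft_cons_listCoboundary, map_sub, Pi.sub_apply, ih]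
    simp

lemma listCoboundary_congr {φ ψ : List α → k} {w : List α}
    (h : ∀ l, l.Sublist w → l.length + 1 = w.length → φ l = ψ l) :
    listCoboundary k α φ w = listCoboundary k α ψ w := by
  induction w generalizing φ ψ with
  | nil => rfl
  | cons x w ih =>
    rw [listCoboundary_cons, listCoboundary_cons, h w (List.sublist_cons_self x w) rfl,
      ih (φ := LinearMap.funLeft k k (List.cons x) φ) (ψ := LinearMap.funLeft k k (List.cons x) ψ)
        (fun l hl hlen => h (x :: l) (hl.cons_cons x) (by simpa using hlen))]

lemma listCoboundary_comp_map (φ : List β → k) (a : α → β) :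
    listCoboundary k α (fun l => φ (l.map a)) = fun l => listCoboundary k β φ (l.map a) := by
  funext w
  induction w generalizing φ with
  | nil => rfl
  | cons x w ih =>
    rw [listCoboundary_cons, List.map_cons, listCoboundary_cons, ← ih]
    rfl

/-- A cochain vanishing on lists with two equal consecutive entries is called normalized;
coboundaries of normalized cochains are normalized. -/
lemma listCoboundary_normalized {φ : List α → k} (h : ∀ l, φ l ≠ 0 → l.IsChain (· ≠ ·))
    {w : List α} (hw : listCoboundary k α φ w ≠ 0) : w.IsChain (· ≠ ·) := by
  induction w generalizing φ with
  | nil => simp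
  | cons x w ih =>
    by_contra hc
    apply hw
    have hx : ∀ l, LinearMap.funLeft k k (List.cons x) φ l ≠ 0 → l.IsChain (· ≠ ·) :=
      fun l hl => (h (x :: l) hl).tail
    rw [listCoboundary_cons]
    by_cases hwc : w.IsChain (· ≠ ·)
    · cases w with
      | nil => simp at hc
      | cons y w =>
        have hxy : x = y := by
          by_contra hne
          exact hc (List.isChain_cons_cons.2 ⟨hne, hwc⟩)
        subst hxy
        have hz : LinearMap.funLeft k k (List.cons x) (LinearMap.funLeft k k (List.cons x) φ)
            = 0 := by
          funext l
          by_contra hl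
          exact (List.isChain_cons_cons.1 (h (x :: x :: l) hl)).1 rfl
        rw [listCoboundary_cons, hz]
        simp [LinearMap.funLeft_apply]
    · have h1 : φ w = 0 := by
        by_contra h1
        exact hwc (h w h1)
      have h2 : listCoboundary k α (LinearMap.funLeft k k (List.cons x) φ) w = 0 := by
        by_contra h2
        exact hwc (ih hx h2)
      rw [h1, h2, sub_zero]

/-- Pullback of cochains along a generalized barycentric subdivision: every element `y` of `Y` has
a barycenter `b y`, and the subdivision of `y` is the cone from `b y` over the subdivision of the
boundary of `y`. -/
def subdivPullback (D : (Y → k) →ₗ[k] (Y → k)) (b : Y → β) : ℕ → (List β → k) →ₗ[k] (Y → k)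
  | 0 => LinearMap.pi fun _ => LinearMap.proj []
  | n + 1 => LinearMap.pi fun y =>
      LinearMap.proj y ∘ₗ D ∘ₗ subdivPullback D b n ∘ₗ LinearMap.funLeft k k (List.cons (b y))

variable {D : (Y → k) →ₗ[k] (Y → k)} {b : Y → β}

lemma subdivPullback_zero (φ : List β → k) (y : Y) : subdivPullback D b 0 φ y = φ [] := rfl

lemma subdivPullback_succ (n : ℕ) (φ : List β → k) (y : Y) :
    subdivPullback D b (n + 1) φ y =
      D (subdivPullback D b n (LinearMap.funLeft k k (List.cons (b y)) φ)) y := rfl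

lemma subdivPullback_coboundary (hD : ∀ c, D (D c) = 0) (n : ℕ) (φ : List β → k) :
    subdivPullback D b (n + 1) (listCoboundary k β φ) = D (subdivPullback D b n φ) := by
  induction n generalizing φ with
  | zero =>
    funext y
    rw [subdivPullback_succ, funLeft_cons_listCoboundary, map_sub, map_sub, Pi.sub_apply]
    have : subdivPullback D b 0
        (listCoboundary k β (LinearMap.funLeft k k (List.cons (b y)) φ)) = 0 := by
      funext z
      rw [subdivPullback_zero]
      rfl
    rw [this]
    simp
  | succ n ih =>
    funext y
    rw [subdivPullback_succ, funLeft_cons_listCoboundary, map_sub, map_sub, Pi.sub_apply, ih, hD]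
    simp

/-- Locality: the pullback at `y` only depends on the values of the cochain at the lists making up
the subdivision of `y`. -/
lemma subdivPullback_congr {r : Y → Y → Prop}
    (hD : ∀ c c' : Y → k, ∀ y, (∀ z, r z y → c z = c' z) → D c y = D c' y)
    {R : ℕ → Y → List β → Prop} (h0 : ∀ y, R 0 y [])
    (hR : ∀ n y z l, r z y → R n z l → R (n + 1) y (b y :: l))
    {n : ℕ} {φ ψ : List β → k} {y : Y} (h : ∀ l, R n y l → φ l = ψ l) :
    subdivPullback D b n φ y = subdivPullback D b n ψ y := by
  induction n generalizing φ ψ y with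
  | zero => exact h [] (h0 y)
  | succ n ih =>
    rw [subdivPullback_succ, subdivPullback_succ]
    exact hD _ _ _ fun z hz => ih fun l hl => h _ (hR n y z l hz hl)

lemma subdivPullback_equivariant {a : Y → Y} {a' : β → β} (hb : ∀ y, b (a y) = a' (b y))
    (hD : ∀ c : Y → k, D (fun y => c (a y)) = fun y => D c (a y)) (n : ℕ) (φ : List β → k) :
    subdivPullback D b n (fun l => φ (l.map a')) = fun y => subdivPullback D b n φ (a y) := by
  induction n generalizing φ with
  | zero => rfl
  | succ n ih =>
    funext y
    rw [subdivPullback_succ, subdivPullback_succ, ← congrFun (hD _) y, ← ih, hb]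
    rfl

end ListCochains

section FaceComplex

open Finset Function

variable {k : Type*} [CommRing k] {ι G : Type*} [LinearOrder ι] [Fintype ι]

/-- The sign picked up when a vertex is inserted into or removed from row `j` of the face `s`. -/
def rowSign (k : Type*) [CommRing k] (j : ι) (s : ι → Option G) : k :=
  ∏ i ∈ univ.filter (· < j), if (s i).isNone then 1 else -1

lemma rowSign_mul_self (j : ι) (s : ι → Option G) : rowSign k j s * rowSign k j s = 1 := by
  rw [rowSign, ← prod_mul_distrib]
  refine prod_eq_one fun i _ => ?_
  split_ifs <;> simp

lemma rowSign_congr {j : ι} {s s' : ι → Option G} (h : ∀ i < j, (s i).isNone = (s' i).isNone) :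
    rowSign k j s = rowSign k j s' := by
  refine prod_congr rfl fun i hi => ?_
  rw [h i (by simpa using hi)]

lemma rowSign_update_of_le {i j : ι} (h : j ≤ i) (s : ι → Option G) (x : Option G) :
    rowSign k j (update s i x) = rowSign k j s :=
  rowSign_congr fun a ha => by rw [update_of_ne (ha.trans_le h).ne]

lemma rowSign_update_of_lt {i j : ι} (h : i < j) (s : ι → Option G) {x : Option G}
    (hx : (s i).isNone ≠ x.isNone) :
    rowSign k j (update s i x) = -rowSign k j s := by
  have hi : i ∈ univ.filter (· < j) := by simpa using h
  rw [rowSign, rowSign, ← mul_prod_erase _ _ hi, ← mul_prod_erase _ _ hi, update_self, ← neg_mul]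
  congr 1
  · cases hs : s i <;> cases x <;> simp_all
  · refine prod_congr rfl fun a ha => ?_
    rw [update_of_ne (ne_of_mem_erase ha)]

/-- Contraction of chains with the dual of the vertex `v`. -/
def contract (k : Type*) [CommRing k] (v : ι × G) :
    ((ι → Option G) → k) →ₗ[k] ((ι → Option G) → k) where
  toFun c s := if s v.1 = none then rowSign k v.1 s * c (update s v.1 (some v.2)) else 0
  map_add' c c' := by
    funext s
    simp only [Pi.add_apply]
    split_ifs <;> ring
  map_smul' a c := by
    funext s
    simp only [Pi.smul_apply, smul_eq_mul, RingHom.id_apply]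
    split_ifs <;> ring

lemma contract_apply (v : ι × G) (c : (ι → Option G) → k) (s : ι → Option G) :
    contract k v c s =
      if s v.1 = none then rowSign k v.1 s * c (update s v.1 (some v.2)) else 0 := rfl

lemma contract_contract_of_lt {v w : ι × G} (h : v.1 < w.1) (c : (ι → Option G) → k) :
    contract k v (contract k w c) = -contract k w (contract k v c) := by
  funext s
  simp only [contract_apply, Pi.neg_apply, update_of_ne h.ne, update_of_ne h.ne']
  by_cases hv : s v.1 = none
  · by_cases hw : s w.1 = none
    · simp only [hv, hw, if_true]
      rw [rowSign_update_of_le h.le, rowSign_update_of_lt h s (by simp [hv]),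
        update_comm h.ne]
      ring
    · simp [hw]
  · simp [hv]

lemma contract_contract_of_eq {v w : ι × G} (h : v.1 = w.1) (c : (ι → Option G) → k) :
    contract k v (contract k w c) = 0 := by
  funext s
  simp [contract_apply, h]

lemma contract_anticomm (v w : ι × G) (c : (ι → Option G) → k) :
    contract k v (contract k w c) = -contract k w (contract k v c) := by
  rcases lt_trichotomy v.1 w.1 with h | h | h
  · exact contract_contract_of_lt h c
  · rw [contract_contract_of_eq h, contract_contract_of_eq h.symm, neg_zero]
  · rw [contract_contract_of_lt h, neg_neg]

/-- The action of a permutation of the colours on faces. -/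
def recolour (e : G ≃ G) (s : ι → Option G) : ι → Option G := fun j => (s j).map e

lemma contract_recolour (e : G ≃ G) (v : ι × G) (c : (ι → Option G) → k) (s : ι → Option G) :
    contract k v (fun s => c (recolour e s)) s = contract k (v.1, e v.2) c (recolour e s) := by
  have h1 : rowSign k v.1 (recolour e s) = rowSign k v.1 s :=
    rowSign_congr fun i _ => by simp [recolour]
  have h2 : recolour e (update s v.1 (some v.2)) = update (recolour e s) v.1 (some (e v.2)) := by
    funext j
    by_cases hj : j = v.1
    · subst hj
      simp [recolour]
    · simp [recolour, hj]
  simp only [contract_apply, h1, h2]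
  simp [recolour]

variable [DecidableEq G]

/-- Exterior multiplication of chains with the vertex `v`. -/
def wedge (k : Type*) [CommRing k] (v : ι × G) :
    ((ι → Option G) → k) →ₗ[k] ((ι → Option G) → k) where
  toFun c s := if s v.1 = some v.2 then rowSign k v.1 s * c (update s v.1 none) else 0
  map_add' c c' := by
    funext s
    simp only [Pi.add_apply]
    split_ifs <;> ring
  map_smul' a c := by
    funext s
    simp only [Pi.smul_apply, smul_eq_mul, RingHom.id_apply]
    split_ifs <;> ring

lemma wedge_apply (v : ι × G) (c : (ι → Option G) → k) (s : ι → Option G) :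
    wedge k v c s = if s v.1 = some v.2 then rowSign k v.1 s * c (update s v.1 none) else 0 := rfl

lemma contract_wedge_of_ne {v w : ι × G} (h : v.1 ≠ w.1) (c : (ι → Option G) → k) :
    contract k w (wedge k v c) = -wedge k v (contract k w c) := by
  funext s
  simp only [contract_apply, wedge_apply, Pi.neg_apply, update_of_ne h, update_of_ne h.symm]
  by_cases hv : s v.1 = some v.2
  · by_cases hw : s w.1 = none
    · simp only [hv, hw, if_true]
      rcases lt_or_gt_of_ne h with h' | h'
      · rw [rowSign_update_of_le h'.le, rowSign_update_of_lt h' s (by simp [hv]),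
          update_comm h]
        ring
      · rw [rowSign_update_of_le h'.le, rowSign_update_of_lt h' s (by simp [hw]),
          update_comm h]
        ring
    · simp [hw]
  · simp [hv]

lemma wedge_contract_apply (v : ι × G) (c : (ι → Option G) → k) (s : ι → Option G) :
    wedge k v (contract k v c) s = if s v.1 = some v.2 then c s else 0 := by
  simp only [contract_apply, wedge_apply, update_self, if_true, update_idem]
  split_ifs with h
  · rw [rowSign_update_of_le le_rfl, ← mul_assoc, rowSign_mul_self, one_mul, ← h, update_eq_self]
  · rfl

variable [Fintype G]

/-- The (augmented) simplicial boundary operator. -/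
def faceBoundary (k : Type*) [CommRing k] (ι G : Type*) [LinearOrder ι] [Fintype ι]
    [DecidableEq G] [Fintype G] : ((ι → Option G) → k) →ₗ[k] ((ι → Option G) → k) :=
  ∑ v : ι × G, contract k v

/-- The (augmented) simplicial coboundary operator. -/
def faceCoboundary (k : Type*) [CommRing k] (ι G : Type*) [LinearOrder ι] [Fintype ι]
    [DecidableEq G] [Fintype G] : ((ι → Option G) → k) →ₗ[k] ((ι → Option G) → k) :=
  ∑ v : ι × G, wedge k v

lemma contract_faceBoundary (v : ι × G) (c : (ι → Option G) → k) :
    contract k v (faceBoundary k ι G c) = -faceBoundary k ι G (contract k v c) := by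
  simp only [faceBoundary, LinearMap.sum_apply, map_sum]
  rw [← sum_neg_distrib]
  exact sum_congr rfl fun w _ => contract_anticomm v w c

lemma faceBoundary_faceBoundary (c : (ι → Option G) → k) :
    faceBoundary k ι G (faceBoundary k ι G c) = 0 := by
  have key : ∀ S : Finset (ι × G), ∑ v ∈ S, ∑ w ∈ S, contract k v (contract k w c) = 0 := by
    intro S
    induction S using Finset.induction_on with
    | empty => simp
    | insert a S ha ih =>
      simp only [sum_insert ha, sum_add_distrib, ih, contract_contract_of_eq (rfl : a.1 = a.1)]
      rw [zero_add, add_zero, ← sum_add_distrib]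
      exact sum_eq_zero fun v _ => by rw [contract_anticomm a v, neg_add_cancel]
  simp only [faceBoundary, LinearMap.sum_apply, map_sum]
  rw [sum_comm]
  exact key univ

lemma sum_mul_contract (v : ι × G) (w c : (ι → Option G) → k) :
    ∑ s, w s * contract k v c s = ∑ s, wedge k v w s * c s := by
  simp only [contract_apply, wedge_apply, mul_ite, mul_zero, ite_mul, zero_mul]
  rw [← sum_filter, ← sum_filter]
  refine sum_bij' (fun s _ => update s v.1 (some v.2)) (fun s _ => update s v.1 none) ?_ ?_ ?_ ?_ ?_
  · simp
  · simp
  · intro s hs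
    rw [mem_filter] at hs
    rw [update_idem, ← hs.2, update_eq_self]
  · intro s hs
    rw [mem_filter] at hs
    rw [update_idem, ← hs.2, update_eq_self]
  · intro s hs
    rw [mem_filter] at hs
    rw [update_idem, rowSign_update_of_le le_rfl, ← hs.2, update_eq_self]
    ring

/-- The coboundary operator is the transpose of the boundary operator. -/
lemma sum_mul_faceBoundary (w c : (ι → Option G) → k) :
    ∑ s, w s * faceBoundary k ι G c s = ∑ s, faceCoboundary k ι G w s * c s := by
  simp only [faceBoundary, faceCoboundary, LinearMap.sum_apply, Finset.sum_apply, mul_sum, sum_mul]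
  rw [sum_comm, sum_comm (s := univ) (t := univ) (f := fun s v => wedge k v w s * c s)]
  exact sum_congr rfl fun v _ => sum_mul_contract v w c

lemma faceCoboundary_faceCoboundary (w : (ι → Option G) → k) :
    faceCoboundary k ι G (faceCoboundary k ι G w) = 0 := by
  classical
  funext s
  have h := sum_mul_faceBoundary w (faceBoundary k ι G (Pi.single s 1))
  rw [faceBoundary_faceBoundary, sum_mul_faceBoundary] at h
  simpa [Pi.single_apply] using h.symm

/-- The cone formula. -/
lemma faceBoundary_wedge (v : ι × G) {c : (ι → Option G) → k}
    (hc : ∀ s, c s ≠ 0 → s v.1 = none) :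
    faceBoundary k ι G (wedge k v c) = c - wedge k v (faceBoundary k ι G c) := by
  have hrow : ∀ w : ι × G, contract k w (wedge k v c) =
      (if w = v then c else 0) - wedge k v (contract k w c) := by
    intro w
    by_cases h : v.1 = w.1
    · have h0 : contract k w c = 0 := by
        funext s
        rw [contract_apply]
        split_ifs
        · rw [show c (update s w.1 (some w.2)) = 0 by
            by_contra hne
            have := hc _ hne
            simp [h] at this]
          simp
        · rfl
      rw [h0, map_zero, sub_zero]
      funext s
      simp only [contract_apply, wedge_apply, h, update_self, update_idem, Option.some_inj]
      by_cases hs : s w.1 = none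
      · by_cases hw : w = v
        · subst hw
          simp only [hs, if_true]
          rw [rowSign_update_of_le le_rfl, ← mul_assoc, rowSign_mul_self, one_mul, ← hs,
            update_eq_self]
        · have : w.2 ≠ v.2 := fun h2 => hw (Prod.ext h.symm h2)
          simp [hs, hw, this]
      · have : c s = 0 := by
          by_contra hne
          exact hs (h ▸ hc s hne)
        simp [hs, ite_apply, this]
    · rw [contract_wedge_of_ne h, if_neg (fun e => h (by rw [e])), zero_sub]
  simp only [faceBoundary, LinearMap.sum_apply, map_sum]
  rw [sum_congr rfl fun w _ => hrow w, sum_sub_distrib]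
  simp

lemma faceBoundary_recolour (e : G ≃ G) (c : (ι → Option G) → k) :
    faceBoundary k ι G (fun s => c (recolour e s)) =
      fun s => faceBoundary k ι G c (recolour e s) := by
  funext s
  simp only [faceBoundary, LinearMap.sum_apply, Finset.sum_apply, contract_recolour]
  exact Fintype.sum_equiv ((Equiv.refl ι).prodCongr e) _ _ fun v => rfl

end FaceComplex

section ChessFace

open Finset Function

variable {ι G : Type*}

/-- Faces of the chessboard complex on the rows `R` and the columns `C`. -/
def ChessFace (R : Finset ι) (C : Finset G) (s : ι → Option G) : Prop :=
  (∀ j g, s j = some g → j ∈ R ∧ g ∈ C) ∧ ∀ i j g, s i = some g → s j = some g → i = j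

lemma ChessFace.mono {R R' : Finset ι} {C C' : Finset G} {s : ι → Option G} (hR : R ⊆ R')
    (hC : C ⊆ C') (h : ChessFace R C s) : ChessFace R' C' s :=
  ⟨fun j g hj => ⟨hR (h.1 j g hj).1, hC (h.1 j g hj).2⟩, h.2⟩

variable [DecidableEq ι]

lemma ChessFace.eq_none {R : Finset ι} {C : Finset G} {s : ι → Option G} {i : ι}
    (h : ChessFace (R.erase i) C s) : s i = none := by
  by_contra hne
  obtain ⟨g, hg⟩ := Option.ne_none_iff_exists'.1 hne
  simpa using (h.1 i g hg).1

variable [DecidableEq G]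

lemma ChessFace.of_update {R : Finset ι} {C : Finset G} {s : ι → Option G} {i : ι} {g : G}
    (hs : s i = none) (h : ChessFace R C (update s i (some g))) :
    ChessFace (R.erase i) (C.erase g) s := by
  have hu : ∀ j a, s j = some a → j ≠ i ∧ update s i (some g) j = some a := by
    intro j a hj
    have : j ≠ i := by
      rintro rfl
      simp [hs] at hj
    exact ⟨this, by rwa [update_of_ne this]⟩
  refine ⟨fun j a hj => ?_, fun j j' a hj hj' => h.2 j j' a (hu j a hj).2 (hu j' a hj').2⟩
  obtain ⟨hji, hj'⟩ := hu j a hj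
  obtain ⟨h1, h2⟩ := h.1 j a hj'
  refine ⟨mem_erase.2 ⟨hji, h1⟩, mem_erase.2 ⟨?_, h2⟩⟩
  rintro rfl
  exact hji (h.2 j i a hj' (by simp))

lemma ChessFace.update_some {R : Finset ι} {C : Finset G} {s : ι → Option G} {i : ι} {g : G}
    (hi : i ∈ R) (hg : g ∈ C) (h : ChessFace (R.erase i) (C.erase g) s) :
    ChessFace R C (update s i (some g)) := by
  have hg' : ∀ j, s j ≠ some g := fun j hj => by simpa using (h.1 j g hj).2
  refine ⟨fun j a hj => ?_, fun j j' a hj hj' => ?_⟩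
  · by_cases hji : j = i
    · subst hji
      simp only [update_self, Option.some_inj] at hj
      exact ⟨hi, hj ▸ hg⟩
    · rw [update_of_ne hji] at hj
      exact ⟨mem_of_mem_erase (h.1 j a hj).1, mem_of_mem_erase (h.1 j a hj).2⟩
  · by_cases hji : j = i <;> by_cases hji' : j' = i
    · rw [hji, hji']
    · subst hji
      rw [update_of_ne hji'] at hj'
      simp only [update_self, Option.some_inj] at hj
      exact absurd (hj ▸ hj') (hg' j')
    · subst hji'
      rw [update_of_ne hji] at hj
      simp only [update_self, Option.some_inj] at hj'
      exact absurd (hj' ▸ hj) (hg' j)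
    · rw [update_of_ne hji] at hj
      rw [update_of_ne hji'] at hj'
      exact h.2 j j' a hj hj'

end ChessFace

section FaceRank

open Finset

variable {ι G : Type*} [Fintype ι]

/-- The number of vertices of a face. -/
def faceRank (s : ι → Option G) : ℕ := #{j | (s j).isSome}

lemma eq_none_of_faceRank_eq_zero {s : ι → Option G} (h : faceRank s = 0) (j : ι) :
    s j = none := by
  have : j ∉ ({i | (s i).isSome} : Finset ι) := by
    rw [card_eq_zero.1 h]
    exact notMem_empty j
  simpa using this

end FaceRank

section Acyclicity

open Finset Function

variable {k : Type*} [CommRing k] {ι G : Type*} [LinearOrder ι] [Fintype ι]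

lemma faceRank_update_some {s : ι → Option G} {j : ι} (hj : s j = none) (g : G) :
    faceRank (update s j (some g)) = faceRank s + 1 := by
  have : ({i | (update s j (some g) i).isSome} : Finset ι) =
      insert j ({i | (s i).isSome} : Finset ι) := by
    ext i
    by_cases hi : i = j
    · subst hi
      simp
    · simp [hi]
  rw [faceRank, this, card_insert_of_notMem (by simp [hj])]
  rfl

lemma faceRank_update_none {s : ι → Option G} {j : ι} {g : G} (hj : s j = some g) :
    faceRank (update s j none) + 1 = faceRank s := by
  rw [← faceRank_update_some (s := update s j none) (j := j) (by simp) g, update_idem, ← hj,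
    update_eq_self]

lemma contract_ne_zero {v : ι × G} {c : (ι → Option G) → k} {s : ι → Option G}
    (h : contract k v c s ≠ 0) : s v.1 = none ∧ c (update s v.1 (some v.2)) ≠ 0 := by
  rw [contract_apply] at h
  split_ifs at h with hs
  · exact ⟨hs, right_ne_zero_of_mul h⟩
  · exact absurd rfl h

variable [DecidableEq G]

lemma wedge_ne_zero {v : ι × G} {c : (ι → Option G) → k} {s : ι → Option G}
    (h : wedge k v c s ≠ 0) : s v.1 = some v.2 ∧ c (update s v.1 none) ≠ 0 := by
  rw [wedge_apply] at h
  split_ifs at h with hs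
  · exact ⟨hs, right_ne_zero_of_mul h⟩
  · exact absurd rfl h

variable [Fintype G]

/-- A cycle is homologous to one avoiding a given set `W` of pairwise non-adjacent vertices,
provided that its links at these vertices can be filled. -/
lemma exists_eliminate {c : (ι → Option G) → k} (W : Finset (ι × G))
    (hW : ∀ s, c s ≠ 0 → ∀ v ∈ W, ∀ w ∈ W, s v.1 = some v.2 → s w.1 = some w.2 → v = w)
    {P : ι × G → (ι → Option G) → Prop} (hP : ∀ v ∈ W, ∀ s, P v s → s v.1 = none)
    (hfill : ∀ v ∈ W, ∃ d : (ι → Option G) → k,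
      faceBoundary k ι G d = contract k v c ∧ ∀ s, d s ≠ 0 → P v s) :
    ∃ e : (ι → Option G) → k,
      (∀ s, e s ≠ 0 → ∃ v ∈ W, s v.1 = some v.2 ∧ P v (update s v.1 none)) ∧
      ∀ s, (c + faceBoundary k ι G e) s ≠ 0 →
        (c s ≠ 0 ∧ ∀ v ∈ W, s v.1 ≠ some v.2) ∨ ∃ v ∈ W, P v s := by
  classical
  choose! d hd hdP using hfill
  refine ⟨∑ v ∈ W, wedge k v (d v), ?_, ?_⟩
  · intro s hs
    rw [Finset.sum_apply] at hs
    obtain ⟨v, hv, hne⟩ := exists_ne_zero_of_sum_ne_zero hs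
    exact ⟨v, hv, (wedge_ne_zero hne).1, hdP v hv _ (wedge_ne_zero hne).2⟩
  · have hb : faceBoundary k ι G (∑ v ∈ W, wedge k v (d v)) =
        ∑ v ∈ W, d v - ∑ v ∈ W, wedge k v (contract k v c) := by
      rw [map_sum, ← sum_sub_distrib]
      refine sum_congr rfl fun v hv => ?_
      rw [faceBoundary_wedge v fun s hs => hP v hv s (hdP v hv s hs), hd v hv]
    intro s hs
    rw [hb] at hs
    by_contra hcon
    push Not at hcon
    obtain ⟨h1, h2⟩ := hcon
    apply hs
    have hd0 : ∑ v ∈ W, d v s = 0 := sum_eq_zero fun v hv => by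
      by_contra hne
      exact h2 v hv (hdP v hv s hne)
    simp only [Pi.add_apply, Pi.sub_apply, Finset.sum_apply, wedge_contract_apply, hd0]
    by_cases hcs : c s = 0
    · simp [hcs]
    · obtain ⟨v, hv, hvs⟩ := h1 hcs
      rw [sum_eq_single v (fun w hw hne => if_neg fun hws => hne (hW s hcs w hw v hv hws hvs))
        (fun h => absurd hv h), if_pos hvs]
      ring

/-- The chessboard complex on `R × C` is acyclic in low degrees. -/
theorem chess_acyclic (m : ℕ) (R : Finset ι) (C : Finset G) (hR : m + 1 ≤ #R) (hC : 2 * m + 1 ≤ #C)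
    (c : (ι → Option G) → k) (hc : ∀ s, c s ≠ 0 → ChessFace R C s ∧ faceRank s = m)
    (hcyc : faceBoundary k ι G c = 0) :
    ∃ c' : (ι → Option G) → k, (∀ s, c' s ≠ 0 → ChessFace R C s ∧ faceRank s = m + 1) ∧
      faceBoundary k ι G c' = c := by
  induction m generalizing R C c with
  | zero =>
    obtain ⟨j, hj⟩ := card_pos.1 (show 0 < #R by omega)
    obtain ⟨g, hg⟩ := card_pos.1 (show 0 < #C by omega)
    refine ⟨wedge k (j, g) c, fun s hs => ?_, ?_⟩
    · obtain ⟨h1, h2⟩ := wedge_ne_zero hs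
      have hr := (hc _ h2).2
      refine ⟨?_, by rw [← faceRank_update_none h1, hr]⟩
      have := ChessFace.update_some (s := update s j none) hj hg
        ⟨fun i a hi => by simp [eq_none_of_faceRank_eq_zero hr i] at hi,
          fun i i' a hi => by simp [eq_none_of_faceRank_eq_zero hr i] at hi⟩
      rwa [update_idem, ← h1, update_eq_self] at this
    · rw [faceBoundary_wedge (j, g) fun s hs => eq_none_of_faceRank_eq_zero (hc s hs).2 j, hcyc]
      simp
  | succ m ih =>
    obtain ⟨j, hj⟩ := card_pos.1 (show 0 < #R by omega)
    obtain ⟨g₀, hg₀⟩ := card_pos.1 (show 0 < #C by omega)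
    -- Avoid the column `g₀`.
    obtain ⟨e₁, he₁, hc₁⟩ := exists_eliminate (c := c) (R ×ˢ {g₀})
      (P := fun v s => ChessFace (R.erase v.1) (C.erase v.2) s ∧ faceRank s = m + 1)
      (fun s hs v hv w hw h1 h2 => by
        simp only [mem_product, mem_singleton] at hv hw
        rw [hv.2] at h1
        rw [hw.2] at h2
        exact Prod.ext ((hc s hs).1.2 _ _ _ h1 h2) (hv.2.trans hw.2.symm))
      (fun v _ s hs => hs.1.eq_none)
      (fun v hv => by
        simp only [mem_product, mem_singleton] at hv
        obtain ⟨d, hd, hd'⟩ := ih (R.erase v.1) (C.erase v.2)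
          (by rw [card_erase_of_mem hv.1]; omega)
          (by rw [hv.2, card_erase_of_mem hg₀]; omega) (contract k v c)
          (fun s hs => by
            obtain ⟨h1, h2⟩ := contract_ne_zero hs
            have h3 := (hc _ h2).2
            rw [faceRank_update_some h1] at h3
            exact ⟨(hc _ h2).1.of_update h1, by omega⟩)
          (by rw [← neg_eq_zero, ← contract_faceBoundary, hcyc, map_zero])
        exact ⟨d, hd', hd⟩)
    set c₁ := c + faceBoundary k ι G e₁ with hc₁def
    have hcyc₁ : faceBoundary k ι G c₁ = 0 := by
      rw [hc₁def, map_add, hcyc, faceBoundary_faceBoundary, add_zero]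
    have hface₁ : ∀ s, c₁ s ≠ 0 → ChessFace R (C.erase g₀) s ∧ faceRank s = m + 1 := by
      intro s hs
      rcases hc₁ s hs with ⟨h1, h2⟩ | ⟨v, hv, h⟩
      · refine ⟨⟨fun i g hi => ?_, (hc s h1).1.2⟩, (hc s h1).2⟩
        obtain ⟨h3, h4⟩ := (hc s h1).1.1 i g hi
        refine ⟨h3, mem_erase.2 ⟨?_, h4⟩⟩
        rintro rfl
        exact h2 (i, g) (by simp [h3]) hi
      · simp only [mem_product, mem_singleton] at hv
        rw [hv.2] at h
        exact ⟨h.1.mono (erase_subset _ _) subset_rfl, h.2⟩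
    -- Avoid the row `j`.
    obtain ⟨e₂, he₂, hc₂⟩ := exists_eliminate (c := c₁) ({j} ×ˢ C.erase g₀)
      (P := fun v s => ChessFace (R.erase v.1) ((C.erase g₀).erase v.2) s ∧ faceRank s = m + 1)
      (fun s hs v hv w hw h1 h2 => by
        simp only [mem_product, mem_singleton] at hv hw
        refine Prod.ext (hv.1.trans hw.1.symm) ?_
        rw [hv.1] at h1
        rw [hw.1, h1] at h2
        exact Option.some_inj.1 h2)
      (fun v _ s hs => hs.1.eq_none)
      (fun v hv => by
        simp only [mem_product, mem_singleton] at hv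
        obtain ⟨d, hd, hd'⟩ := ih (R.erase v.1) ((C.erase g₀).erase v.2)
          (by rw [hv.1, card_erase_of_mem hj]; omega)
          (by rw [card_erase_of_mem hv.2, card_erase_of_mem hg₀]; omega) (contract k v c₁)
          (fun s hs => by
            obtain ⟨h1, h2⟩ := contract_ne_zero hs
            have h3 := (hface₁ _ h2).2
            rw [faceRank_update_some h1] at h3
            exact ⟨(hface₁ _ h2).1.of_update h1, by omega⟩)
          (by rw [← neg_eq_zero, ← contract_faceBoundary, hcyc₁, map_zero])
        exact ⟨d, hd', hd⟩)
    set c₂ := c₁ + faceBoundary k ι G e₂ with hc₂def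
    have hcyc₂ : faceBoundary k ι G c₂ = 0 := by
      rw [hc₂def, map_add, hcyc₁, faceBoundary_faceBoundary, add_zero]
    have hface₂ : ∀ s, c₂ s ≠ 0 → ChessFace (R.erase j) (C.erase g₀) s ∧ faceRank s = m + 1 := by
      intro s hs
      rcases hc₂ s hs with ⟨h1, h2⟩ | ⟨v, hv, h⟩
      · refine ⟨⟨fun i g hi => ?_, (hface₁ s h1).1.2⟩, (hface₁ s h1).2⟩
        obtain ⟨h3, h4⟩ := (hface₁ s h1).1.1 i g hi
        refine ⟨mem_erase.2 ⟨?_, h3⟩, h4⟩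
        rintro rfl
        exact h2 (i, g) (by simpa using h4) hi
      · simp only [mem_product, mem_singleton] at hv
        rw [hv.1] at h
        exact ⟨h.1.mono subset_rfl (erase_subset _ _), h.2⟩
    refine ⟨wedge k (j, g₀) c₂ - e₁ - e₂, fun s hs => ?_, ?_⟩
    · have hput : ∀ (v : ι × G), v.1 ∈ R → v.2 ∈ C → s v.1 = some v.2 →
          ChessFace (R.erase v.1) (C.erase v.2) (update s v.1 none) →
          faceRank (update s v.1 none) = m + 1 → ChessFace R C s ∧ faceRank s = m + 1 + 1 := by
        intro v h1 h2 h3 h4 h5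
        refine ⟨?_, by rw [← faceRank_update_none h3, h5]⟩
        have := h4.update_some h1 h2
        rwa [update_idem, ← h3, update_eq_self] at this
      by_cases h1 : e₁ s = 0
      · by_cases h2 : e₂ s = 0
        · have h3 : wedge k (j, g₀) c₂ s ≠ 0 := by simpa [h1, h2] using hs
          obtain ⟨h4, h5⟩ := wedge_ne_zero h3
          exact hput (j, g₀) hj hg₀ h4 (hface₂ _ h5).1 (hface₂ _ h5).2
        · obtain ⟨v, hv, h4, h5, h6⟩ := he₂ s h2
          simp only [mem_product, mem_singleton, mem_erase] at hv
          refine hput v (hv.1 ▸ hj) hv.2.2 h4 (h5.mono subset_rfl ?_) h6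
          exact erase_subset_erase _ (erase_subset _ _)
      · obtain ⟨v, hv, h4, h5, h6⟩ := he₁ s h1
        simp only [mem_product, mem_singleton] at hv
        exact hput v hv.1 (hv.2 ▸ hg₀) h4 h5 h6
    · rw [map_sub, map_sub, faceBoundary_wedge (j, g₀) fun s hs => (hface₂ s hs).1.eq_none,
        hcyc₂, map_zero, hc₂def, hc₁def]
      abel

/-- Faces on the rows `R ∪ U` whose colours are pairwise distinct on `R`. -/
def MixedFace (R U : Finset ι) (s : ι → Option G) : Prop :=
  (∀ j, s j ≠ none → j ∈ R ∨ j ∈ U) ∧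
    ∀ i ∈ R, ∀ j ∈ R, ∀ g, s i = some g → s j = some g → i = j

/-- The join of a chessboard complex with discrete sets of colours, one for each row in `U`, is
acyclic below its dimension. -/
theorem mixed_acyclic [Nonempty G] (R U : Finset ι) (hRU : Disjoint R U)
    (hR : 2 * #R ≤ Fintype.card G + 1) (m : ℕ) (hm : m + 1 ≤ #R + #U)
    (c : (ι → Option G) → k) (hc : ∀ s, c s ≠ 0 → MixedFace R U s ∧ faceRank s = m)
    (hcyc : faceBoundary k ι G c = 0) :
    ∃ c' : (ι → Option G) → k, (∀ s, c' s ≠ 0 → MixedFace R U s ∧ faceRank s = m + 1) ∧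
      faceBoundary k ι G c' = c := by
  induction U using Finset.induction_on generalizing m c with
  | empty =>
    have hiff : ∀ s : ι → Option G, MixedFace R ∅ s ↔ ChessFace R univ s := by
      intro s
      constructor
      · intro h
        have hmem : ∀ j g, s j = some g → j ∈ R := fun j g hj => by
          simpa using h.1 j (by simp [hj])
        exact ⟨fun j g hj => ⟨hmem j g hj, mem_univ g⟩,
          fun i j g hi hj => h.2 i (hmem i g hi) j (hmem j g hj) g hi hj⟩
      · intro h
        refine ⟨fun j hj => ?_, fun i _ j _ g => h.2 i j g⟩
        obtain ⟨g, hg⟩ := Option.ne_none_iff_exists'.1 hj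
        exact Or.inl (h.1 j g hg).1
    simp only [hiff] at hc ⊢
    rw [card_empty] at hm
    exact chess_acyclic m R univ (by omega) (by rw [card_univ]; omega) c hc hcyc
  | insert j U hj ih =>
    have hjR : j ∉ R := fun h => disjoint_left.1 hRU h (mem_insert_self j U)
    have hRU' : Disjoint R U := hRU.mono_right (subset_insert j U)
    rw [card_insert_of_notMem hj] at hm
    have hrow : ∀ s : ι → Option G, MixedFace R U s → s j = none := fun s hs => by
      by_contra hne
      rcases hs.1 j hne with h | h
      exacts [hjR h, hj h]
    have hupd : ∀ (s : ι → Option G) (x : Option G), MixedFace R (insert j U) s →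
        MixedFace R (insert j U) (update s j x) := by
      intro s x hs
      refine ⟨fun i hi => ?_, fun i hi i' hi' g h1 h2 => ?_⟩
      · by_cases hij : i = j
        · exact Or.inr (hij ▸ mem_insert_self j U)
        · rw [update_of_ne hij] at hi
          exact hs.1 i hi
      · rw [update_of_ne (ne_of_mem_of_not_mem hi hjR)] at h1
        rw [update_of_ne (ne_of_mem_of_not_mem hi' hjR)] at h2
        exact hs.2 i hi i' hi' g h1 h2
    have hdrop : ∀ s : ι → Option G, MixedFace R (insert j U) s → s j = none →
        MixedFace R U s := by
      refine fun s hs hsj => ⟨fun i hi => ?_, hs.2⟩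
      rcases hs.1 i hi with h | h
      · exact Or.inl h
      · rcases mem_insert.1 h with rfl | h
        · exact absurd hsj hi
        · exact Or.inr h
    have hgrow : ∀ s : ι → Option G, MixedFace R U s → MixedFace R (insert j U) s :=
      fun s hs => ⟨fun i hi => (hs.1 i hi).imp_right (mem_insert_of_mem), hs.2⟩
    obtain ⟨e, he, hc₂⟩ := exists_eliminate (c := c) ({j} ×ˢ univ)
      (P := fun _ s => MixedFace R U s ∧ faceRank s = m)
      (fun s hs v hv w hw h1 h2 => by
        simp only [mem_product, mem_singleton] at hv hw
        refine Prod.ext (hv.1.trans hw.1.symm) ?_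
        rw [hv.1] at h1
        rw [hw.1, h1] at h2
        exact Option.some_inj.1 h2)
      (fun v hv s hs => by
        simp only [mem_product, mem_singleton] at hv
        exact hv.1 ▸ hrow s hs.1)
      (fun v hv => by
        simp only [mem_product, mem_singleton] at hv
        have hlink : ∀ s, contract k v c s ≠ 0 → MixedFace R U s ∧ faceRank s + 1 = m := by
          intro s hs
          obtain ⟨h1, h2⟩ := contract_ne_zero hs
          obtain ⟨h3, h4⟩ := hc _ h2
          rw [faceRank_update_some h1] at h4
          refine ⟨hdrop s ?_ (hv.1 ▸ h1), h4⟩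
          have := hupd _ none h3
          rw [hv.1] at h1
          rwa [hv.1, update_idem, ← h1, update_eq_self] at this
        cases m with
        | zero =>
          refine ⟨0, ?_, fun s hs => absurd rfl hs⟩
          rw [map_zero]
          funext s
          by_contra hne
          have := (hlink s (Ne.symm hne)).2
          omega
        | succ m =>
          obtain ⟨d, hd, hd'⟩ := ih hRU' m (by omega) (contract k v c)
            (fun s hs => ⟨(hlink s hs).1, by have := (hlink s hs).2; omega⟩)
            (by rw [← neg_eq_zero, ← contract_faceBoundary, hcyc, map_zero])
          exact ⟨d, hd', hd⟩)
    set c₂ := c + faceBoundary k ι G e with hc₂def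
    have hcyc₂ : faceBoundary k ι G c₂ = 0 := by
      rw [hc₂def, map_add, hcyc, faceBoundary_faceBoundary, add_zero]
    have hface₂ : ∀ s, c₂ s ≠ 0 → MixedFace R U s ∧ faceRank s = m := by
      intro s hs
      rcases hc₂ s hs with ⟨h1, h2⟩ | ⟨v, hv, h⟩
      · refine ⟨hdrop s (hc s h1).1 ?_, (hc s h1).2⟩
        by_contra hne
        obtain ⟨g, hg⟩ := Option.ne_none_iff_exists'.1 hne
        exact h2 (j, g) (by simp) hg
      · exact h
    obtain ⟨g₀⟩ := ‹Nonempty G›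
    refine ⟨wedge k (j, g₀) c₂ - e, fun s hs => ?_, ?_⟩
    · have hput : ∀ g, s j = some g → MixedFace R U (update s j none) →
          faceRank (update s j none) = m →
          MixedFace R (insert j U) s ∧ faceRank s = m + 1 := by
        intro g h3 h4 h5
        refine ⟨?_, by rw [← faceRank_update_none h3, h5]⟩
        have := hupd _ (some g) (hgrow _ h4)
        rwa [update_idem, ← h3, update_eq_self] at this
      by_cases h1 : e s = 0
      · have h3 : wedge k (j, g₀) c₂ s ≠ 0 := by simpa [h1] using hs
        obtain ⟨h4, h5⟩ := wedge_ne_zero h3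
        exact hput g₀ h4 (hface₂ _ h5).1 (hface₂ _ h5).2
      · obtain ⟨v, hv, h4, h5, h6⟩ := he s h1
        simp only [mem_product, mem_singleton] at hv
        rw [hv.1] at h4 h5 h6
        exact hput v.2 h4 h5 h6
    · rw [map_sub, faceBoundary_wedge (j, g₀) fun s hs => hrow s (hface₂ s hs).1,
        hcyc₂, map_zero, hc₂def]
      abel

end Acyclicity

section WeylRelation

variable {A : Type*} [Ring A] {t s e : A}

lemma mul_pow_of_commutator (hts : t * s - s * t = e) (hes : e * s = s * e) (n : ℕ) :
    t * s ^ (n + 1) = s ^ (n + 1) * t + (n + 1 : ℕ) • (s ^ n * e) := by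
  have h1 : t * s = s * t + e := by rw [← hts, add_sub_cancel]
  induction n with
  | zero => simp [h1]
  | succ n ih =>
    rw [pow_succ s (n + 1), ← mul_assoc, ih, add_mul, mul_assoc, h1, mul_add, ← mul_assoc,
      add_assoc, smul_mul_assoc, mul_assoc (s ^ n) e s, hes, ← mul_assoc (s ^ n) s e, ← pow_succ,
      succ_nsmul (s ^ (n + 1) * e), ← pow_succ]
    abel

lemma pow_mul_of_commutator (hts : t * s - s * t = e) (het : e * t = t * e) (n : ℕ) :
    t ^ (n + 1) * s = s * t ^ (n + 1) + (n + 1 : ℕ) • (t ^ n * e) := by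
  have h1 : t * s = s * t + e := by rw [← hts, add_sub_cancel]
  have hcomm : ∀ n : ℕ, e * t ^ n = t ^ n * e := fun n => (Commute.pow_right het n).eq
  induction n with
  | zero => simp [h1]
  | succ n ih =>
    rw [pow_succ' t (n + 1), mul_assoc, ih, mul_add, ← mul_assoc, h1, add_mul, mul_assoc,
      hcomm, mul_smul_comm, ← mul_assoc t, ← pow_succ', ← pow_succ',
      succ_nsmul (t ^ (n + 1) * e) (n + 1)]
    abel

end WeylRelation

section Exactness

variable {F M : Type*} [Field F] {p : ℕ} [hp : Fact p.Prime] [CharP F p] [AddCommGroup M]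
  [Module F M] {t s e : Module.End F M} {c : M}

lemma natCast_ne_zero_of_lt (F : Type*) [Field F] {p : ℕ} [CharP F p] {n : ℕ} (h0 : n ≠ 0)
    (hn : n < p) : (n : F) ≠ 0 := fun h =>
  h0 (Nat.eq_zero_of_dvd_of_lt ((CharP.cast_eq_zero_iff F p n).1 h) hn)

lemma exists_pow_apply_of_apply_eq_zero (hts : t * s - s * t = e) (hes : e * s = s * e)
    (hec : e c = c) (htc : t c = 0) : ∃ w, (t ^ (p - 1)) w = c := by
  have key : ∀ n < p, ∃ w, (t ^ n) w = c ∧ ∃ a : F, a ≠ 0 ∧ w = a • (s ^ n) c := by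
    intro n
    induction n with
    | zero => exact fun _ => ⟨c, rfl, 1, one_ne_zero, by simp⟩
    | succ n ih =>
      intro hn
      obtain ⟨w, hw, a, ha, rfl⟩ := ih (by omega)
      have hne : ((n + 1 : ℕ) : F) ≠ 0 := natCast_ne_zero_of_lt F (p := p) (by omega) hn
      refine ⟨(a * ((n + 1 : ℕ) : F)⁻¹) • (s ^ (n + 1)) c, ?_, _,
        mul_ne_zero ha (inv_ne_zero hne), rfl⟩
      have h1 : t ((s ^ (n + 1)) c) = (n + 1) • (s ^ n) c := by
        have := congrArg (fun f : Module.End F M => f c) (mul_pow_of_commutator hts hes n)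
        simpa [htc, hec, succ_nsmul] using this
      rw [pow_succ, Module.End.mul_apply, map_smul, h1, ← Nat.cast_smul_eq_nsmul F, smul_smul,
        mul_assoc, inv_mul_cancel₀ hne, mul_one, hw]
  obtain ⟨w, hw, -⟩ := key (p - 1) (Nat.sub_lt hp.out.pos one_pos)
  exact ⟨w, hw⟩

lemma exists_apply_of_pow_apply_eq_zero (hts : t * s - s * t = e) (het : e * t = t * e)
    (hes : e * s = s * e) (hec : e c = c) (htc : (t ^ (p - 1)) c = 0) : ∃ w, t w = c := by
  have key : ∀ n < p, ∀ c, e c = c → (t ^ n) c = 0 → ∃ w, t w = c := by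
    intro n
    induction n with
    | zero => exact fun _ c _ h => ⟨0, by simpa using h.symm⟩
    | succ n ih =>
      intro hn c hec hc
      have hne : ((n + 1 : ℕ) : F) ≠ 0 := natCast_ne_zero_of_lt F (p := p) (by omega) hn
      have h1 : (t ^ (n + 1)) (s c) = (n + 1) • (t ^ n) c := by
        have := congrArg (fun f : Module.End F M => f c) (pow_mul_of_commutator hts het n)
        simpa [hc, hec, succ_nsmul] using this
      have h2 : e (t (s c)) = t (s c) := by
        have := congrArg (fun f : Module.End F M => f c) (show e * (t * s) = t * s * e by
          rw [← mul_assoc, het, mul_assoc, hes, mul_assoc])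
        simpa [hec] using this
      obtain ⟨w, hw⟩ := ih (by omega) (t (s c) - (n + 1) • c)
        (by rw [map_sub, map_nsmul, h2, hec])
        (by rw [map_sub, map_nsmul, ← Module.End.mul_apply, ← pow_succ, h1, sub_self])
      refine ⟨((n + 1 : ℕ) : F)⁻¹ • (s c - w), ?_⟩
      rw [map_smul, map_sub, hw, sub_sub_cancel, ← Nat.cast_smul_eq_nsmul F, smul_smul,
        inv_mul_cancel₀ hne, one_smul]
  exact key (p - 1) (Nat.sub_lt hp.out.pos one_pos) c hec htc

end Exactness

section ShiftOperators

variable {F : Type*} (Y : Type*) [Field F] [AddAction F Y]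

/-- Translation of functions by an element of the group acting. -/
def shift (g : F) : Module.End F (Y → F) := LinearMap.funLeft F F (g +ᵥ ·)

variable {Y} in
@[simp]
lemma shift_apply (g : F) (c : Y → F) (y : Y) : shift Y g c y = c (g +ᵥ y) := rfl

/-- The action of the group algebra on functions. -/
noncomputable def groupAlgebraAction : AddMonoidAlgebra F F →ₐ[F] Module.End F (Y → F) :=
  AddMonoidAlgebra.lift F (Module.End F (Y → F)) F
    { toFun := fun g => shift Y g.toAdd
      map_one' := by
        ext1 c
        funext y
        simp
      map_mul' := fun g h => by
        ext1 c
        funext y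
        simp only [toAdd_mul, Module.End.mul_apply, shift_apply, vadd_vadd]
        rw [add_comm] }

lemma groupAlgebraAction_single (g a : F) :
    groupAlgebraAction Y (AddMonoidAlgebra.single g a) = a • shift Y g := by
  simp [groupAlgebraAction]

variable {β : Type*} [Fintype β]

/-- The operator `∑ aᵢ (shift bᵢ - 1)`. -/
def differenceOp (a b : β → F) : Module.End F (Y → F) := ∑ i, a i • (shift Y (b i) - 1)

variable {Y} in
lemma differenceOp_apply (a b : β → F) (c : Y → F) (y : Y) :
    differenceOp Y a b c y = ∑ i, a i * (c (b i +ᵥ y) - c y) := by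
  simp [differenceOp, LinearMap.sum_apply]

lemma differenceOp_eq (a b : β → F) : differenceOp Y a b = groupAlgebraAction Y
    (∑ i, (AddMonoidAlgebra.single (b i) (a i) - AddMonoidAlgebra.single 0 (a i))) := by
  have h0 : shift Y (0 : F) = 1 := by
    ext1 c
    funext y
    simp
  simp [differenceOp, groupAlgebraAction_single, h0, smul_sub]

variable {p : ℕ} [hp : Fact p.Prime] [CharP F p]

instance charP_groupAlgebra : CharP (AddMonoidAlgebra F F) p :=
  charP_of_injective_algebraMap (algebraMap F (AddMonoidAlgebra F F)).injective p

lemma single_pow_charP {F : Type*} [Field F] {p : ℕ} [CharP F p] (g a : F) :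
    (AddMonoidAlgebra.single g a : AddMonoidAlgebra F F) ^ p =
    AddMonoidAlgebra.single 0 (a ^ p) := by
  rw [AddMonoidAlgebra.single_pow]
  simp

lemma differenceOp_pow_char (a b : β → F) : differenceOp Y a b ^ p = 0 := by
  rw [differenceOp_eq, ← map_pow, sum_pow_char]
  simp [sub_pow_char]

end ShiftOperators

section EquivariantExactness

open Finset

variable {F Y β : Type*} [Field F] [AddAction F Y] [Fintype β] {p : ℕ} [hp : Fact p.Prime]

/-- A choice of a linear functional for each orbit, vanishing on the stabilizer, together with a
function which is affine along the orbits with these functionals as linear parts. -/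
lemma exists_orbit_functional [Module (ZMod p) F] :
    ∃ (ψ : Y → F →ₗ[ZMod p] ZMod p) (φ : Y → ZMod p),
      (∀ (g : F) y, ψ (g +ᵥ y) = ψ y) ∧ (∀ (g : F) y, φ (g +ᵥ y) = φ y + ψ y g) ∧
      ∀ y, (∃ g : F, g +ᵥ y ≠ y) → ψ y ≠ 0 := by
  have hex : ∀ y : Y, ∃ ψ : F →ₗ[ZMod p] ZMod p,
      (∀ g : F, g +ᵥ y = y → ψ g = 0) ∧ ((∃ g : F, g +ᵥ y ≠ y) → ψ ≠ 0) := by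
    intro y
    by_cases h : ∃ g : F, g +ᵥ y ≠ y
    · obtain ⟨g, hg⟩ := h
      have hlt : AddSubgroup.toZModSubmodule p (AddAction.stabilizer F y) < ⊤ := by
        rw [lt_top_iff_ne_top]
        intro htop
        have : g ∈ AddSubgroup.toZModSubmodule p (AddAction.stabilizer F y) := by
          rw [htop]
          trivial
        exact hg this
      obtain ⟨ψ, hψ, hle⟩ := Submodule.exists_le_ker_of_lt_top _ hlt
      exact ⟨ψ, fun g hg => hle hg, fun _ => hψ⟩
    · exact ⟨0, fun _ _ => rfl, fun h' => absurd h' h⟩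
  choose ψ hψ0 hψ1 using hex
  let rep : Y → Y := fun y => (Quotient.mk (AddAction.orbitRel F Y) y).out
  have hrep : ∀ y, ∃ g : F, g +ᵥ rep y = y := fun y => by
    have h : (AddAction.orbitRel F Y).r (rep y) y := Quotient.mk_out (s := AddAction.orbitRel F Y) y
    exact (AddAction.orbitRel F Y).symm h
  have hrepv : ∀ (g : F) y, rep (g +ᵥ y) = rep y := fun g y => by
    have : Quotient.mk (AddAction.orbitRel F Y) (g +ᵥ y) = Quotient.mk _ y :=
      Quotient.sound ⟨g, rfl⟩
    simp only [rep, this]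
  choose a ha using hrep
  refine ⟨fun y => ψ (rep y), fun y => ψ (rep y) (a y), fun g y => by simp only [hrepv],
    fun g y => ?_, fun y ⟨g, hg⟩ => hψ1 _ ⟨g, fun h => hg ?_⟩⟩
  · have h1 : (a (g +ᵥ y) - a y - g) +ᵥ rep y = rep y := by
      have h2 : a (g +ᵥ y) +ᵥ rep y = (g + a y) +ᵥ rep y := by
        rw [add_vadd, ha, ← hrepv g y, ha]
      rw [show a (g +ᵥ y) - a y - g = -(g + a y) + a (g +ᵥ y) by ring, add_vadd, h2,
        neg_vadd_vadd]
    have h3 := hψ0 _ _ h1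
    rw [map_sub, map_sub] at h3
    simp only [hrepv]
    linear_combination h3
  · rw [← ha y, vadd_vadd, add_comm, ← vadd_vadd, h]

lemma indicator_one_vadd {F Y : Type*} [Field F] [AddAction F Y] {T : Set Y}
    (hT : ∀ (g : F), ∀ y ∈ T, g +ᵥ y ∈ T) (g : F) (y : Y) :
    T.indicator (1 : Y → F) (g +ᵥ y) = T.indicator 1 y := by
  classical
  have : g +ᵥ y ∈ T ↔ y ∈ T := ⟨fun h => by simpa using hT (-g) _ h, hT g y⟩
  simp only [Set.indicator_apply, this, Pi.one_apply]

variable [Algebra (ZMod p) F] [CharP F p]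

lemma exists_weyl_partner [Finite F] (b : Module.Basis β (ZMod p) F) {T : Set Y}
    (hT : ∀ (g : F), ∀ y ∈ T, g +ᵥ y ∈ T) (hfree : ∀ y ∈ T, ∃ g : F, g +ᵥ y ≠ y) :
    ∃ s : Module.End F (Y → F),
      differenceOp Y b b * s - s * differenceOp Y b b = LinearMap.mulLeft F (T.indicator 1) ∧
      LinearMap.mulLeft F (T.indicator 1) * s = s * LinearMap.mulLeft F (T.indicator 1) := by
  classical
  obtain ⟨ψ, φ, hψ, hφ, hne⟩ := exists_orbit_functional (F := F) (Y := Y) (p := p)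
  have : Finite (F →ₗ[ZMod p] ZMod p) := DFunLike.finite _
  have := Fintype.ofFinite (F →ₗ[ZMod p] ZMod p)
  have hT' : ∀ (g : F) y, g +ᵥ y ∈ T ↔ y ∈ T := fun g y =>
    ⟨fun h => by simpa using hT (-g) _ h, hT g y⟩
  have hTind := indicator_one_vadd hT
  have hcomm : ∀ x : AddMonoidAlgebra F F, LinearMap.mulLeft F (T.indicator (1 : Y → F)) *
      groupAlgebraAction Y x = groupAlgebraAction Y x * LinearMap.mulLeft F (T.indicator 1) := by
    intro x
    induction x using AddMonoidAlgebra.induction_on with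
    | of g =>
      have : groupAlgebraAction Y (AddMonoidAlgebra.of F F (Multiplicative.ofAdd g)) =
          shift Y g := by
        simpa using groupAlgebraAction_single Y g (1 : F)
      rw [this]
      ext1 c
      funext y
      simp [hTind]
    | add x y hx hy => rw [map_add, mul_add, add_mul, hx, hy]
    | smul r x hx => rw [map_smul, mul_smul_comm, smul_mul_assoc, hx]
  -- the commutator with multiplication by `φ` and its inverse, on each isotypic part
  let ν : (F →ₗ[ZMod p] ZMod p) → AddMonoidAlgebra F F := fun f =>
    ∑ i, AddMonoidAlgebra.single (b i) (b i * algebraMap (ZMod p) F (f (b i)))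
  let κ : (F →ₗ[ZMod p] ZMod p) → F := fun f => ∑ i, b i * algebraMap (ZMod p) F (f (b i))
  let m : (F →ₗ[ZMod p] ZMod p) → Y → F := fun f y =>
    if y ∈ T ∧ ψ y = f then algebraMap (ZMod p) F (φ y) else 0
  have hν : ∀ f, ν f ^ p = algebraMap F _ (κ f ^ p) := by
    intro f
    simp only [ν, κ]
    rw [sum_pow_char, sum_pow_char, map_sum]
    refine sum_congr rfl fun i _ => ?_
    rw [single_pow_charP]
    rfl
  have hκ : ∀ f, f ≠ 0 → κ f ≠ 0 := by
    intro f hf h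
    apply hf
    refine b.ext fun i => ?_
    refine Fintype.linearIndependent_iff.1 b.linearIndependent (fun i => f (b i)) ?_ i
    rw [← h]
    exact sum_congr rfl fun i _ => by rw [Algebra.smul_def, mul_comm]
  have hcom : ∀ f, differenceOp Y b b * LinearMap.mulLeft F (m f) -
      LinearMap.mulLeft F (m f) * differenceOp Y b b =
      LinearMap.mulLeft F (fun y => if y ∈ T ∧ ψ y = f then 1 else 0) *
        groupAlgebraAction Y (ν f) := by
    intro f
    ext1 c
    funext y
    have h1 : groupAlgebraAction Y (ν f) c y =
        ∑ i, b i * algebraMap (ZMod p) F (f (b i)) * c (b i +ᵥ y) := by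
      simp [ν, map_sum, groupAlgebraAction_single, LinearMap.sum_apply]
    simp only [LinearMap.sub_apply, Module.End.mul_apply, Pi.sub_apply, differenceOp_apply,
      LinearMap.mulLeft_apply, Pi.mul_apply, h1, m, hT', hψ, hφ]
    split_ifs with h
    · rw [mul_sum, mul_sum, ← sum_sub_distrib]
      refine sum_congr rfl fun i _ => ?_
      rw [h.2, map_add]
      ring
    · simp
  refine ⟨∑ f, LinearMap.mulLeft F (m f) * groupAlgebraAction Y
    (algebraMap F _ (κ f ^ p)⁻¹ * ν f ^ (p - 1)), ?_, ?_⟩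
  · have hsum : LinearMap.mulLeft F (T.indicator (1 : Y → F)) =
        ∑ f, LinearMap.mulLeft F (fun y => if y ∈ T ∧ ψ y = f then 1 else 0) *
          groupAlgebraAction Y (algebraMap F _ (κ f ^ p)⁻¹ * ν f ^ p) := by
      ext1 c
      funext y
      rw [LinearMap.sum_apply, Finset.sum_apply]
      simp only [hν, ← map_mul, AlgHom.commutes, Module.End.mul_apply, LinearMap.mulLeft_apply,
        Pi.mul_apply, Module.algebraMap_end_apply, Pi.smul_apply, smul_eq_mul]
      rw [sum_eq_single (ψ y)]
      · by_cases hy : y ∈ T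
        · rw [inv_mul_cancel₀ (pow_ne_zero _ (hκ _ (hne y (hfree y hy))))]
          simp [hy]
        · simp [hy]
      · intro f _ hf
        simp [hf.symm]
      · simp
    rw [hsum, mul_sum, sum_mul, ← sum_sub_distrib]
    refine sum_congr rfl fun f _ => ?_
    have hc2 : differenceOp Y b b * groupAlgebraAction Y
        (algebraMap F _ (κ f ^ p)⁻¹ * ν f ^ (p - 1)) = groupAlgebraAction Y
        (algebraMap F _ (κ f ^ p)⁻¹ * ν f ^ (p - 1)) * differenceOp Y b b := by
      rw [differenceOp_eq, ← map_mul, ← map_mul, mul_comm]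
    rw [mul_assoc (LinearMap.mulLeft F (m f)), ← hc2, ← mul_assoc, ← mul_assoc, ← sub_mul, hcom,
      mul_assoc, ← map_mul, mul_left_comm, ← pow_succ', Nat.sub_add_cancel hp.out.one_le]
  · rw [mul_sum, sum_mul]
    refine sum_congr rfl fun f _ => ?_
    have hmul : LinearMap.mulLeft F (T.indicator (1 : Y → F)) * LinearMap.mulLeft F (m f) =
        LinearMap.mulLeft F (m f) * LinearMap.mulLeft F (T.indicator (1 : Y → F)) := by
      ext1 c
      simp [mul_left_comm]
    rw [mul_assoc, ← hcomm, ← mul_assoc, ← mul_assoc, hmul]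

/-- On functions supported on non-fixed points, the kernel of one of `t`, `t ^ (p - 1)` is the
image of the other one, where `t` is the operator `∑ bᵢ (shift bᵢ - 1)`. -/
theorem differenceOp_exact [Finite F] (b : Module.Basis β (ZMod p) F) {T : Set Y}
    (hT : ∀ (g : F), ∀ y ∈ T, g +ᵥ y ∈ T) (hfree : ∀ y ∈ T, ∃ g : F, g +ᵥ y ≠ y)
    {i j : ℕ} (hij : (i = 1 ∧ j = p - 1) ∨ (i = p - 1 ∧ j = 1))
    {c : Y → F} (hc : ∀ y, c y ≠ 0 → y ∈ T) (htc : (differenceOp Y b b ^ i) c = 0) :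
    ∃ w : Y → F, (∀ y, w y ≠ 0 → y ∈ T) ∧ (differenceOp Y b b ^ j) w = c := by
  obtain ⟨s, hs, hes⟩ := exists_weyl_partner b hT hfree
  set t := differenceOp Y b b with ht
  set e := LinearMap.mulLeft F (T.indicator (1 : Y → F)) with he
  have het : e * t = t * e := by
    ext1 c
    funext y
    simp only [he, ht, Module.End.mul_apply, LinearMap.mulLeft_apply, Pi.mul_apply,
      differenceOp_apply, indicator_one_vadd hT, ← mul_sub, mul_sum, mul_left_comm]
  have hec : e c = c := by
    funext y
    by_cases hy : c y = 0
    · simp [e, hy]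
    · simp [e, hc y hy]
  obtain ⟨w, hw⟩ : ∃ w, (t ^ j) w = c := by
    rcases hij with ⟨rfl, rfl⟩ | ⟨rfl, rfl⟩
    · exact exists_pow_apply_of_apply_eq_zero hs hes hec (by simpa using htc)
    · simpa using exists_apply_of_pow_apply_eq_zero hs het hes hec htc
  refine ⟨e w, fun y hy => ?_, ?_⟩
  · by_contra h
    simp [e, h] at hy
  · rw [← Module.End.mul_apply, ← (Commute.pow_right het j).eq, Module.End.mul_apply, hw, hec]

end EquivariantExactness

section ListAction

variable {F α : Type*} [AddMonoid F] [AddAction F α]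

instance listAddAction : AddAction F (List α) where
  vadd g l := l.map (g +ᵥ ·)
  zero_vadd l := by
    change l.map _ = l
    simp
  add_vadd g h l := by
    change l.map _ = (l.map _).map _
    simp [add_vadd, Function.comp_def]

lemma list_vadd_eq (g : F) (l : List α) : g +ᵥ l = l.map (g +ᵥ ·) := rfl

instance optionAddAction : AddAction F (Option α) where
  zero_vadd x := by cases x <;> simp
  add_vadd g h x := by cases x <;> simp [add_vadd]

lemma pi_option_vadd_apply {ι : Type*} (g : F) (s : ι → Option α) (j : ι) :
    (g +ᵥ s) j = Option.map (g +ᵥ ·) (s j) := rfl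

end ListAction

section EquivariantMaps

open Finset

variable {F Y Z β : Type*} [Field F] [AddAction F Y] [AddAction F Z] [Fintype β]

lemma map_differenceOp (a b : β → F) (L : (Y → F) →ₗ[F] (Z → F))
    (hL : ∀ (g : F) c, L (shift Y g c) = shift Z g (L c)) (j : ℕ) (c : Y → F) :
    L ((differenceOp Y a b ^ j) c) = (differenceOp Z a b ^ j) (L c) := by
  have h1 : ∀ c, L (differenceOp Y a b c) = differenceOp Z a b (L c) := by
    intro c
    simp [differenceOp, LinearMap.sum_apply, map_sum, hL]
  induction j generalizing c with
  | zero => rfl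
  | succ j ih => rw [pow_succ, pow_succ, Module.End.mul_apply, Module.End.mul_apply, ih, h1]

lemma sum_differenceOp_mul [Fintype Y] (a b : β → F) (u z : Y → F) (j : ℕ) :
    ∑ s, (differenceOp Y a b ^ j) u s * z s =
      ∑ s, u s * (differenceOp Y a (-b) ^ j) z s := by
  have h1 : ∀ u z : Y → F,
      ∑ s, differenceOp Y a b u s * z s = ∑ s, u s * differenceOp Y a (-b) z s := by
    intro u z
    simp only [differenceOp_apply, sum_mul, mul_sum]
    rw [sum_comm, sum_comm (f := fun s i => u s * (a i * (z ((-b) i +ᵥ s) - z s)))]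
    refine sum_congr rfl fun i _ => ?_
    simp only [mul_sub, sub_mul, sum_sub_distrib]
    congr 1
    · rw [← Equiv.sum_comp (AddAction.toPerm (b i))
        (fun s => u s * (a i * z ((-b) i +ᵥ s)))]
      refine sum_congr rfl fun s _ => ?_
      simp only [AddAction.toPerm_apply, Pi.neg_apply, neg_vadd_vadd]
      ring
    · exact sum_congr rfl fun s _ => by ring
  induction j generalizing u with
  | zero => rfl
  | succ j ih => rw [pow_succ, Module.End.mul_apply, ih, h1, pow_succ', Module.End.mul_apply]

lemma differenceOp_pow_support (a b : β → F) {T : Set Y} (hT : ∀ (g : F), ∀ y ∈ T, g +ᵥ y ∈ T)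
    (j : ℕ) {c : Y → F} (hc : ∀ y, c y ≠ 0 → y ∈ T) :
    ∀ y, (differenceOp Y a b ^ j) c y ≠ 0 → y ∈ T := by
  induction j with
  | zero => exact hc
  | succ j ih =>
    intro y hy
    by_contra hyT
    apply hy
    rw [pow_succ', Module.End.mul_apply, differenceOp_apply]
    refine sum_eq_zero fun i _ => ?_
    have h1 : ∀ z, z ∉ T → (differenceOp Y a b ^ j) c z = 0 := fun z hz => by
      by_contra h
      exact hz (ih z h)
    rw [h1 y hyT, h1 _ fun h => hyT (by simpa using hT (-b i) _ h), sub_zero, mul_zero]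

lemma differenceOp_eq_zero_of_invariant (a b : β → F) {c : Y → F}
    (hc : ∀ (g : F) y, c (g +ᵥ y) = c y) : differenceOp Y a b c = 0 := by
  funext y
  simp [differenceOp_apply, hc]

end EquivariantMaps

section Obstruction

open Finset Function

variable {F α β : Type*} [Field F]

/-- The coboundary of cochains on the complex of the lists satisfying `W`. -/
noncomputable def relCoboundary (W : Set (List α)) : (List α → F) →ₗ[F] (List α → F) :=
  LinearMap.mulLeft F (W.indicator 1) ∘ₗ listCoboundary F α

lemma relCoboundary_of_mem {W : Set (List α)} {l : List α} (hl : l ∈ W) (w : List α → F) :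
    relCoboundary W w l = listCoboundary F α w l := by
  simp [relCoboundary, hl]

lemma relCoboundary_of_notMem {W : Set (List α)} {l : List α} (hl : l ∉ W) (w : List α → F) :
    relCoboundary W w l = 0 := by
  simp [relCoboundary, hl]

lemma relCoboundary_relCoboundary {W : Set (List α)}
    (hsub : ∀ l ∈ W, ∀ l', l'.Sublist l → l' ∈ W) (w : List α → F) :
    relCoboundary W (relCoboundary W w) = 0 := by
  funext l
  by_cases hl : l ∈ W
  · rw [relCoboundary_of_mem hl, listCoboundary_congr (ψ := listCoboundary F α w)
      fun l' hl' _ => relCoboundary_of_mem (hsub l hl l' hl') w, listCoboundary_listCoboundary]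
  · exact relCoboundary_of_notMem hl _

lemma relCoboundary_shift [AddAction F α] {W : Set (List α)}
    (hW : ∀ (g : F), ∀ l ∈ W, g +ᵥ l ∈ W) (g : F)
    (w : List α → F) :
    relCoboundary W (shift (List α) g w) = shift (List α) g (relCoboundary W w) := by
  funext l
  have := congrFun (listCoboundary_comp_map w (g +ᵥ · : α → α)) l
  simp only [relCoboundary, LinearMap.comp_apply, LinearMap.mulLeft_apply, Pi.mul_apply,
    shift_apply, indicator_one_vadd hW]
  exact congrArg _ this

lemma MixedFace.vadd {ι : Type*} {V U : Finset ι} {s : ι → Option F} (h : MixedFace V U s) (g : F) :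
    MixedFace V U (g +ᵥ s) := by
  have hsome : ∀ j a, (g +ᵥ s) j = some a → s j = some (-g + a) := by
    intro j a hj
    change Option.map _ (s j) = some a at hj
    obtain ⟨x, hx, rfl⟩ := Option.map_eq_some_iff.1 hj
    simpa using hx
  refine ⟨fun j hj => h.1 j fun h0 => hj ?_, fun i hi j hj a h1 h2 =>
    h.2 i hi j hj (-g + a) (hsome i a h1) (hsome j a h2)⟩
  change Option.map _ (s j) = none
  rw [h0]
  rfl

lemma faceRank_vadd {ι : Type*} [Fintype ι] (s : ι → Option F) (g : F) :
    faceRank (g +ᵥ s) = faceRank s := by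
  unfold faceRank
  congr 1
  ext j
  simp only [pi_option_vadd_apply, Option.isSome_map]

lemma faceBoundary_shift {ι F : Type*} [LinearOrder ι] [Fintype ι] [Field F] [Fintype F]
    [DecidableEq F] (g : F) (c : (ι → Option F) → F) :
    faceBoundary F ι F (shift _ g c) = shift _ g (faceBoundary F ι F c) :=
  faceBoundary_recolour (Equiv.addLeft g) c

variable {ι : Type*} [LinearOrder ι] [Fintype ι] [AddAction F α] [Fintype β] [Fintype F]
  [DecidableEq F] {p : ℕ} [hp : Fact p.Prime] [Algebra (ZMod p) F] [CharP F p]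

/-- There is no equivariant cochain map from a complex of lists without fixed points and of small
dimension to the cochains of a highly acyclic complex. -/
theorem no_equivariant_cochain_map (b : Module.Basis β (ZMod p) F) {N : ℕ}
    (hN : Fintype.card ι = N + 1) {V : Finset ι}
    (hV : 2 * #V ≤ Fintype.card F + 1) {W : Set (List α)} (hnil : [] ∈ W)
    (hsub : ∀ l ∈ W, ∀ l', l'.Sublist l → l' ∈ W) (hW : ∀ (g : F), ∀ l ∈ W, g +ᵥ l ∈ W)
    (hfree : ∀ l ∈ W, l ≠ [] → ∃ g : F, g +ᵥ l ≠ l)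
    (hlen : ∀ l ∈ W, l.IsChain (· ≠ ·) → l.length ≤ N)
    (Ψ : ℕ → (List α → F) →ₗ[F] ((ι → Option F) → F))
    (hΨ0 : ∀ φ s, Ψ 0 φ s = φ [])
    (hΨd : ∀ n φ, Ψ (n + 1) (listCoboundary F α φ) = faceCoboundary F ι F (Ψ n φ))
    (hΨg : ∀ n (g : F) φ, Ψ n (shift _ g φ) = shift _ g (Ψ n φ))
    (hΨloc : ∀ n s φ φ', MixedFace V Vᶜ s → faceRank s = n →
      (∀ l ∈ W, l.length = n → φ l = φ' l) → Ψ n φ s = Ψ n φ' s) : False := by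
  have hp2 := hp.out.two_le
  set t := differenceOp (List α) b b with ht
  set t' := differenceOp (ι → Option F) b (-b) with ht'
  let T : Set (List α) := {l | l ≠ [] ∧ l ∈ W ∧ l.IsChain (· ≠ ·)}
  have hT : ∀ (g : F), ∀ l ∈ T, g +ᵥ l ∈ T := by
    rintro g l ⟨h1, h2, h3⟩
    refine ⟨by simpa [list_vadd_eq] using h1, hW g l h2, ?_⟩
    rw [list_vadd_eq, List.isChain_map]
    simpa using h3
  have lift_chain : ∀ m n i j : ℕ, ((i = 1 ∧ j = p - 1) ∨ (i = p - 1 ∧ j = 1)) → n + m = N →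
      ∀ (w : List α → F) (z : (ι → Option F) → F),
      (∀ l, w l ≠ 0 → l ∈ W ∧ l.IsChain (· ≠ ·)) → (t ^ i) (relCoboundary W w) = 0 →
      (∀ s, z s ≠ 0 → MixedFace V Vᶜ s ∧ faceRank s = n) → faceBoundary F ι F z = 0 →
      (t' ^ j) z = 0 → ∑ s, Ψ n w s * z s = 0 := by
    intro m
    induction m with
    | zero =>
      intro n i j hij hn w z hw htw hz hz0 htz
      obtain ⟨x, hx, rfl⟩ := mixed_acyclic V Vᶜ disjoint_compl_right hV n
        (by rw [card_add_card_compl, hN]; omega) z hz hz0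
      rw [sum_mul_faceBoundary, ← hΨd]
      refine sum_eq_zero fun s _ => ?_
      by_cases hs : x s = 0
      · rw [hs, mul_zero]
      · rw [hΨloc (n + 1) s _ 0 (hx s hs).1 (hx s hs).2, map_zero, Pi.zero_apply, zero_mul]
        intro l hl hl'
        by_contra hne
        have := hlen l hl (listCoboundary_normalized (fun l hl => (hw l hl).2) hne)
        omega
    | succ m ih =>
      intro n i j hij hn w z hw htw hz hz0 htz
      obtain ⟨x, hx, rfl⟩ := mixed_acyclic V Vᶜ disjoint_compl_right hV n
        (by rw [card_add_card_compl, hN]; omega) z hz hz0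
      obtain ⟨w', hw', hww'⟩ := differenceOp_exact b hT (fun l hl => hfree l hl.2.1 hl.1) hij
        (c := relCoboundary W w) (fun l hl => by
          have hlW : l ∈ W := by
            by_contra h
            exact hl (relCoboundary_of_notMem h w)
          rw [relCoboundary_of_mem hlW] at hl
          refine ⟨?_, hlW, listCoboundary_normalized (fun l hl => (hw l hl).2) hl⟩
          rintro rfl
          exact hl rfl) htw
      have h1 : ∑ s, Ψ n w s * faceBoundary F ι F x s =
          ∑ s, Ψ (n + 1) (relCoboundary W w) s * x s := by
        rw [sum_mul_faceBoundary, ← hΨd]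
        refine sum_congr rfl fun s _ => ?_
        by_cases hs : x s = 0
        · rw [hs, mul_zero, mul_zero]
        · rw [hΨloc (n + 1) s _ _ (hx s hs).1 (hx s hs).2
            fun l hl _ => (relCoboundary_of_mem hl w).symm]
      rw [h1, ← hww', map_differenceOp _ _ (Ψ (n + 1)) (hΨg (n + 1)), sum_differenceOp_mul]
      refine ih (n + 1) j i (by tauto) (by omega) w' _ (fun l hl => (hw' l hl).2) ?_ ?_ ?_ ?_
      · rw [← map_differenceOp _ _ _ (relCoboundary_shift hW), hww',
          relCoboundary_relCoboundary hsub]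
      · exact differenceOp_pow_support (T := {s | MixedFace V Vᶜ s ∧ faceRank s = n + 1}) _ _
          (fun g s hs => ⟨hs.1.vadd g, by rw [faceRank_vadd]; exact hs.2⟩) j hx
      · rw [map_differenceOp _ _ _ faceBoundary_shift]
        exact htz
      · rw [← Module.End.mul_apply, ← pow_add, show i + j = p by omega, differenceOp_pow_char]
        rfl
  classical
  let w₀ : List α → F := fun l => if l = [] then 1 else 0
  let z₀ : (ι → Option F) → F := fun s => if s = fun _ => none then 1 else 0
  have h := lift_chain N 0 1 (p - 1) (Or.inl ⟨rfl, rfl⟩) (by omega) w₀ z₀ ?_ ?_ ?_ ?_ ?_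
  · simp [hΨ0, w₀, z₀] at h
  · intro l hl
    have : l = [] := by
      by_contra h
      simp [w₀, h] at hl
    subst this
    exact ⟨hnil, by simp⟩
  · rw [← map_differenceOp _ _ _ (relCoboundary_shift hW), pow_one,
      differenceOp_eq_zero_of_invariant, map_zero]
    intro g l
    simp [w₀, list_vadd_eq]
  · intro s hs
    have : s = fun _ => none := by
      by_contra h
      simp [z₀, h] at hs
    subst this
    exact ⟨⟨by simp, by simp⟩, by simp [faceRank]⟩
  · funext s
    simp only [faceBoundary, LinearMap.sum_apply, Finset.sum_apply, Pi.zero_apply]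
    refine sum_eq_zero fun v _ => ?_
    rw [contract_apply]
    have : update s v.1 (some v.2) ≠ fun _ => none := fun h => by
      simpa using congrFun h v.1
    simp [z₀, this]
  · obtain ⟨m, hm⟩ : ∃ m, p - 1 = m + 1 := ⟨p - 2, by omega⟩
    rw [hm, pow_succ, Module.End.mul_apply, differenceOp_eq_zero_of_invariant, map_zero]
    intro g s
    have : (g +ᵥ s = fun _ => none) ↔ s = fun _ => none := by
      constructor
      · intro h
        funext j
        have hj : Option.map (g + ·) (s j) = none := congrFun h j
        simpa using hj
      · rintro rfl
        rfl
    simp only [z₀, this]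

end Obstruction

section GoodFlags

open Finset
open scoped Pointwise

variable {κ F : Type*} [Fintype F]

/-- Families of proper subsets of `F`, not all of them empty. -/
def GoodLabel (B : κ → Finset F) : Prop := (∃ i, (B i).Nonempty) ∧ ∀ i, B i ≠ univ

/-- Decreasing lists of good labels. -/
def goodFlags (κ F : Type*) [Fintype F] : Set (List (κ → Finset F)) :=
  {l | l.Pairwise (· ≥ ·) ∧ ∀ B ∈ l, GoodLabel B}

lemma nil_mem_goodFlags : [] ∈ goodFlags κ F := ⟨List.Pairwise.nil, by simp⟩

lemma goodFlags_sublist (l : List (κ → Finset F)) (hl : l ∈ goodFlags κ F)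
    (l' : List (κ → Finset F)) (h : l'.Sublist l) : l' ∈ goodFlags κ F :=
  ⟨hl.1.sublist h, fun B hB => hl.2 B (h.subset hB)⟩

lemma GoodLabel.one_le [Fintype κ] {B : κ → Finset F} (hB : GoodLabel B) : 1 ≤ ∑ i, #(B i) := by
  obtain ⟨i, hi⟩ := hB.1
  exact (card_pos.2 hi).trans_le (single_le_sum (f := fun i => #(B i)) (by simp) (mem_univ i))

lemma GoodLabel.le_mul [Fintype κ] {B : κ → Finset F} (hB : GoodLabel B) :
    ∑ i, #(B i) ≤ Fintype.card κ * (Fintype.card F - 1) := by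
  refine (sum_le_card_nsmul univ _ (Fintype.card F - 1) fun i _ => ?_).trans_eq (by simp)
  exact Nat.le_sub_one_of_lt (card_lt_card (ssubset_univ_iff.2 (hB.2 i)))

lemma length_le_of_mem_goodFlags [Fintype κ] {l : List (κ → Finset F)} (hl : l ∈ goodFlags κ F)
    (hne : l.IsChain (· ≠ ·)) : l.length ≤ Fintype.card κ * (Fintype.card F - 1) := by
  have key : ∀ (l : List (κ → Finset F)) (B : κ → Finset F), B :: l ∈ goodFlags κ F →
      (B :: l).IsChain (· ≠ ·) → (B :: l).length ≤ ∑ i, #(B i) := by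
    intro l
    induction l with
    | nil => exact fun B hB _ => (hB.2 B (by simp)).one_le
    | cons C l ih =>
      intro B hB hc
      have h1 := ih C (goodFlags_sublist _ hB _ (List.sublist_cons_self _ _)) hc.tail
      have hle : C ≤ B := (List.pairwise_cons.1 hB.1).1 C (by simp)
      have hlt : C < B := lt_of_le_of_ne hle (List.isChain_cons_cons.1 hc).1.symm
      obtain ⟨-, i, hi⟩ := Pi.lt_def.1 hlt
      have : ∑ i, #(C i) < ∑ i, #(B i) :=
        sum_lt_sum (fun j _ => card_le_card (hle j)) ⟨i, mem_univ i, card_lt_card hi⟩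
      rw [List.length_cons]
      omega
  cases l with
  | nil => simp
  | cons B l => exact (key l B hl hne).trans (hl.2 B (by simp)).le_mul

variable [Field F] [DecidableEq F]

lemma goodFlags_vadd (g : F) (l : List (κ → Finset F)) (hl : l ∈ goodFlags κ F) :
    g +ᵥ l ∈ goodFlags κ F := by
  refine ⟨?_, ?_⟩
  · rw [list_vadd_eq, List.pairwise_map]
    exact hl.1.imp fun h i => Finset.vadd_finset_subset_vadd_finset (h i)
  · intro B hB
    rw [list_vadd_eq, List.mem_map] at hB
    obtain ⟨C, hC, rfl⟩ := hB
    obtain ⟨⟨i, hi⟩, h⟩ := hl.2 C hC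
    refine ⟨⟨i, hi.vadd_finset⟩, fun i hi => h i ?_⟩
    have : #(g +ᵥ C i) = #(C i) := card_vadd_finset g (C i)
    rw [← card_eq_iff_eq_univ, ← this]
    exact (card_eq_iff_eq_univ _).2 hi

lemma goodFlags_free (l : List (κ → Finset F)) (hl : l ∈ goodFlags κ F) (hne : l ≠ []) :
    ∃ g : F, g +ᵥ l ≠ l := by
  cases l with
  | nil => exact absurd rfl hne
  | cons B l =>
    obtain ⟨⟨i, a, ha⟩, h⟩ := hl.2 B (by simp)
    obtain ⟨c, hc⟩ : ∃ c, c ∉ B i := by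
      by_contra hall
      push Not at hall
      exact h i (eq_univ_of_forall hall)
    refine ⟨c - a, fun heq => hc ?_⟩
    rw [list_vadd_eq, List.map_cons, List.cons.injEq] at heq
    rw [← congrFun heq.1 i, Pi.vadd_apply, mem_vadd_finset]
    exact ⟨a, ha, by simp⟩

end GoodFlags

section Subdivision

open Finset

variable {E : Type*} [NormedAddCommGroup E] [NormedSpace ℝ E]

/-- The average of the entries of a list. -/
noncomputable def listAverage (v : List E) : E := (v.length : ℝ)⁻¹ • v.sum

lemma listAverage_mem_convexHull {v : List E} (hv : v ≠ []) :
    listAverage v ∈ convexHull ℝ {x | x ∈ v} := by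
  have hpos : (0 : ℝ) < v.length := by exact_mod_cast List.length_pos_iff.2 hv
  have h1 : listAverage v = ∑ i : Fin v.length, (v.length : ℝ)⁻¹ • v.get i := by
    rw [listAverage, ← smul_sum]
    congr 1
    conv_lhs => rw [← List.ofFn_get v]
    rw [List.sum_ofFn]
  rw [h1]
  refine (convex_convexHull ℝ _).sum_mem (fun _ _ => by positivity) ?_ fun i _ =>
    subset_convexHull ℝ _ (List.get_mem v i)
  simp [hpos.ne']

lemma norm_sum_sub_le {D : ℝ} (y : E) (v : List E) (h : ∀ x ∈ v, dist x y ≤ D) :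
    ‖v.sum - (v.length : ℝ) • y‖ ≤ v.length * D := by
  induction v with
  | nil => simp
  | cons x v ih =>
    have h1 := ih fun z hz => h z (List.mem_cons_of_mem _ hz)
    have h2 := h x (by simp)
    rw [dist_eq_norm] at h2
    have h3 : (x :: v).sum - ((x :: v).length : ℝ) • y =
        (x - y) + (v.sum - (v.length : ℝ) • y) := by
      rw [List.sum_cons, List.length_cons]
      push_cast
      module
    rw [h3, List.length_cons]
    push_cast
    linarith [norm_add_le (x - y) (v.sum - (v.length : ℝ) • y)]

lemma dist_listAverage_le {D : ℝ} {v : List E} (h : ∀ x ∈ v, ∀ y ∈ v, dist x y ≤ D) {y : E}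
    (hy : y ∈ convexHull ℝ {x | x ∈ v}) :
    dist y (listAverage v) ≤ ((v.length - 1 : ℝ) / v.length) * D := by
  have hsub : convexHull ℝ {x | x ∈ v} ⊆
      Metric.closedBall (listAverage v) (((v.length - 1 : ℝ) / v.length) * D) := by
    refine convexHull_min (fun y (hy : y ∈ v) => ?_) (convex_closedBall _ _)
    have hpos : (0 : ℝ) < v.length := by exact_mod_cast List.length_pos_of_mem hy
    classical
    have hperm := List.perm_cons_erase hy
    have h1 := norm_sum_sub_le y (v.erase y) fun x hx => h x (List.mem_of_mem_erase hx) y hy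
    have hlen : ((v.erase y).length : ℝ) = v.length - 1 := by
      rw [hperm.length_eq]
      simp
    have h2 : listAverage v - y =
        (v.length : ℝ)⁻¹ • ((v.erase y).sum - ((v.erase y).length : ℝ) • y) := by
      rw [listAverage, hperm.sum_eq, List.sum_cons, hlen, eq_inv_smul_iff₀ hpos.ne', smul_sub,
        smul_inv_smul₀ hpos.ne']
      module
    rw [Metric.mem_closedBall, dist_comm, dist_eq_norm, h2, norm_smul, norm_inv,
      Real.norm_of_nonneg hpos.le, div_mul_eq_mul_div, inv_mul_eq_div]
    gcongr
    rwa [hlen] at h1 ⊢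
  exact hsub hy

variable (k : Type*) [CommRing k] (E)

/-- Pullback of cochains along the barycentric subdivision. -/
noncomputable def averagePullback (n : ℕ) : Module.End k (List E → k) :=
  subdivPullback (listCoboundary k E) listAverage n

variable {k E}

lemma averagePullback_congr {N : ℕ} {D : ℝ} {C : Set E} (hC : Convex ℝ C) {v : List E}
    (hvC : ∀ x ∈ v, x ∈ C) (hlen : v.length ≤ N + 1) (hD : ∀ x ∈ v, ∀ y ∈ v, dist x y ≤ D)
    {n : ℕ} {φ ψ : List E → k}
    (h : ∀ l : List E, l.length = n → (∀ x ∈ l, x ∈ C) →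
      (∀ x ∈ l, ∀ y ∈ l, dist x y ≤ (N / (N + 1) : ℝ) * D) → φ l = ψ l) :
    averagePullback E k n φ v = averagePullback E k n ψ v := by
  refine subdivPullback_congr (r := fun z y => z.Sublist y ∧ z.length + 1 = y.length)
    (R := fun n v l => l.length = n ∧ (∀ x ∈ l, x ∈ convexHull ℝ {x | x ∈ v}) ∧
      (v.length ≤ N + 1 → (∀ x ∈ v, ∀ y ∈ v, dist x y ≤ D) →
        ∀ x ∈ l, ∀ y ∈ l, dist x y ≤ (N / (N + 1) : ℝ) * D))
    (fun c c' y hc => listCoboundary_congr fun l h1 h2 => hc l ⟨h1, h2⟩) (fun y => by simp) ?_ ?_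
  · rintro n v z l ⟨hzv, hlen⟩ ⟨h1, h2, h3⟩
    have hv : v ≠ [] := by
      rintro rfl
      simp at hlen
    have hmono : convexHull ℝ {x | x ∈ z} ⊆ convexHull ℝ {x | x ∈ v} :=
      convexHull_mono fun x hx => hzv.subset hx
    refine ⟨by simp [h1], ?_, fun hv' hD => ?_⟩
    · rintro x hx
      rcases List.mem_cons.1 hx with rfl | hx
      · exact listAverage_mem_convexHull hv
      · exact hmono (h2 x hx)
    · have hD0 : 0 ≤ D := by
        obtain ⟨x, hx⟩ := List.exists_mem_of_ne_nil v hv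
        exact dist_nonneg.trans (hD x hx x hx)
      have hpos : (0 : ℝ) < v.length := by exact_mod_cast List.length_pos_iff.2 hv
      have hb : ∀ y ∈ l, dist y (listAverage v) ≤ (N / (N + 1) : ℝ) * D := by
        intro y hy
        refine (dist_listAverage_le hD (hmono (h2 y hy))).trans ?_
        gcongr ?_ * D
        rw [div_le_div_iff₀ hpos (by positivity)]
        have : (v.length : ℝ) ≤ N + 1 := by exact_mod_cast hv'
        nlinarith
      rintro x hx y hy
      rcases List.mem_cons.1 hx with rfl | hx <;> rcases List.mem_cons.1 hy with rfl | hy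
      · rw [dist_self]
        positivity
      · rw [dist_comm]
        exact hb y hy
      · exact hb x hx
      · exact h3 (by omega) (fun x hx y hy => hD x (hzv.subset hx) y (hzv.subset hy)) x hx y hy
  · rintro l ⟨h1, h2, h3⟩
    exact h l h1 (fun x hx => convexHull_min hvC hC (h2 x hx)) (h3 hlen hD)

lemma averagePullback_pow_congr {N n : ℕ} (hn : n ≤ N + 1) {C : Set E} (hC : Convex ℝ C) (m : ℕ)
    {D : ℝ} {v : List E} (hvC : ∀ x ∈ v, x ∈ C) (hlen : v.length = n)
    (hD : ∀ x ∈ v, ∀ y ∈ v, dist x y ≤ D) {φ ψ : List E → k}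
    (h : ∀ l : List E, l.length = n → (∀ x ∈ l, x ∈ C) →
      (∀ x ∈ l, ∀ y ∈ l, dist x y ≤ (N / (N + 1) : ℝ) ^ m * D) → φ l = ψ l) :
    (averagePullback E k n ^ m) φ v = (averagePullback E k n ^ m) ψ v := by
  induction m generalizing D v with
  | zero => exact h v hlen hvC (by simpa using hD)
  | succ m ih =>
    rw [pow_succ', Module.End.mul_apply, Module.End.mul_apply]
    refine averagePullback_congr hC hvC (hlen.trans_le hn) hD fun l h1 h2 h3 =>
      ih h2 h1 h3 fun l' h1' h2' h3' => h l' h1' h2' ?_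
    rwa [pow_succ, mul_assoc]

lemma averagePullback_pow_coboundary (n m : ℕ) (φ : List E → k) :
    (averagePullback E k (n + 1) ^ m) (listCoboundary k E φ) =
      listCoboundary k E ((averagePullback E k n ^ m) φ) := by
  induction m with
  | zero => rfl
  | succ m ih =>
    rw [pow_succ', pow_succ', Module.End.mul_apply, Module.End.mul_apply, ih, averagePullback,
      averagePullback, subdivPullback_coboundary listCoboundary_listCoboundary]

lemma averagePullback_zero_pow (m : ℕ) (φ : List E → k) :
    (averagePullback E k 0 ^ m) φ [] = φ [] := by
  induction m with
  | zero => rfl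
  | succ m ih =>
    rw [pow_succ', Module.End.mul_apply, averagePullback, subdivPullback_zero]
    exact ih

lemma averagePullback_pow_equivariant (a : E →ₗ[ℝ] E) (n m : ℕ) (φ : List E → k) :
    (averagePullback E k n ^ m) (fun l => φ (l.map a)) =
      fun v => (averagePullback E k n ^ m) φ (v.map a) := by
  induction m with
  | zero => rfl
  | succ m ih =>
    rw [pow_succ', Module.End.mul_apply, Module.End.mul_apply, ih]
    exact subdivPullback_equivariant (a := List.map a) (a' := a)
      (fun v => by simp [listAverage, map_list_sum])
      (fun c => listCoboundary_comp_map c a) n _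

end Subdivision

section FaceCoboundaryFacts

open Finset Function

variable {k : Type*} [CommRing k] {ι G : Type*} [LinearOrder ι] [Fintype ι] [DecidableEq G]
  [Fintype G]

lemma faceCoboundary_congr {c c' : (ι → Option G) → k} {s : ι → Option G}
    (h : ∀ j, s j ≠ none → c (update s j none) = c' (update s j none)) :
    faceCoboundary k ι G c s = faceCoboundary k ι G c' s := by
  simp only [faceCoboundary, LinearMap.sum_apply, Finset.sum_apply]
  refine sum_congr rfl fun v _ => ?_
  rw [wedge_apply, wedge_apply]
  split_ifs with hv
  · rw [h v.1 (by simp [hv])]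
  · rfl

lemma faceCoboundary_recolour (e : G ≃ G) (c : (ι → Option G) → k) :
    faceCoboundary k ι G (fun s => c (recolour e s)) =
      fun s => faceCoboundary k ι G c (recolour e s) := by
  funext s
  simp only [faceCoboundary, LinearMap.sum_apply, Finset.sum_apply]
  refine Fintype.sum_equiv ((Equiv.refl ι).prodCongr e) _ _ fun v => ?_
  have h1 : rowSign k v.1 (recolour e s) = rowSign k v.1 s :=
    rowSign_congr fun i _ => by simp [recolour]
  have h2 : recolour e (update s v.1 none) = update (recolour e s) v.1 none := by
    funext j
    by_cases hj : j = v.1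
    · subst hj
      simp [recolour]
    · simp [recolour, hj]
  have h3 : recolour e s v.1 = some (e v.2) ↔ s v.1 = some v.2 := by
    simp [recolour, Option.map_eq_some_iff]
  simp only [wedge_apply, Equiv.prodCongr_apply, Prod.map_fst, Prod.map_snd, Equiv.refl_apply, h1,
    h2, h3]

end FaceCoboundaryFacts

section ConfigurationSimplex

open Finset Function

variable (ι F : Type*) [Fintype ι] [Fintype F]

/-- The simplex on the vertex set `ι × F`. -/
def configSimplex : Set (ι → F → ℝ) := {x | (∀ j g, 0 ≤ x j g) ∧ ∑ j, ∑ g, x j g = 1}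

variable {ι F}

/-- The closed cell of the face `s` in the simplex on `ι × F`. -/
def faceCell (s : ι → Option F) : Set (ι → F → ℝ) :=
  {x | x ∈ configSimplex ι F ∧ ∀ j g, x j g ≠ 0 → s j = some g}

lemma le_one_of_mem_configSimplex {x : ι → F → ℝ} (hx : x ∈ configSimplex ι F) (j : ι) (g : F) :
    x j g ≤ 1 := by
  rw [← hx.2]
  exact (single_le_sum (f := fun g => x j g) (fun g _ => hx.1 j g) (mem_univ g)).trans
    (single_le_sum (f := fun j => ∑ g, x j g) (fun j _ => sum_nonneg fun g _ => hx.1 j g)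
      (mem_univ j))

lemma dist_le_one_of_mem_configSimplex {x y : ι → F → ℝ} (hx : x ∈ configSimplex ι F)
    (hy : y ∈ configSimplex ι F) : dist x y ≤ 1 := by
  refine (dist_pi_le_iff zero_le_one).2 fun j => (dist_pi_le_iff zero_le_one).2 fun g => ?_
  rw [Real.dist_eq, abs_le]
  constructor <;> linarith [hx.1 j g, hy.1 j g, le_one_of_mem_configSimplex hx j g,
    le_one_of_mem_configSimplex hy j g]

lemma isCompact_faceCell (s : ι → Option F) : IsCompact (faceCell s) := by
  refine (isCompact_Icc (a := (0 : ι → F → ℝ)) (b := 1)).of_isClosed_subset ?_ fun x hx =>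
    ⟨fun j g => hx.1.1 j g, fun j g => le_one_of_mem_configSimplex hx.1 j g⟩
  have hcoord : ∀ j g, Continuous fun x : ι → F → ℝ => x j g := fun j g => by fun_prop
  have heq : faceCell s = ((⋂ j, ⋂ g, {x : ι → F → ℝ | 0 ≤ x j g}) ∩
      {x | ∑ j, ∑ g, x j g = 1}) ∩ ⋂ j, ⋂ g, {x | x j g ≠ 0 → s j = some g} := by
    ext x
    simp [faceCell, configSimplex]
  rw [heq]
  refine ((isClosed_iInter fun j => isClosed_iInter fun g =>
    isClosed_le continuous_const (hcoord j g)).inter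
      (isClosed_eq (by fun_prop) continuous_const)).inter
        (isClosed_iInter fun j => isClosed_iInter fun g => ?_)
  by_cases h : s j = some g
  · simp [h]
  · simpa [h] using isClosed_eq (hcoord j g) continuous_const

lemma convex_faceCell (s : ι → Option F) : Convex ℝ (faceCell s) := by
  rintro x ⟨⟨hx0, hx1⟩, hxs⟩ y ⟨⟨hy0, hy1⟩, hys⟩ a b ha hb hab
  refine ⟨⟨fun j g => ?_, ?_⟩, fun j g hne => ?_⟩
  · have := hx0 j g
    have := hy0 j g
    simp only [Pi.add_apply, Pi.smul_apply, smul_eq_mul]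
    positivity
  · simp only [Pi.add_apply, Pi.smul_apply, smul_eq_mul, sum_add_distrib, ← mul_sum, hx1, hy1]
    linarith
  · by_contra h
    apply hne
    have h1 : x j g = 0 := by
      by_contra h'
      exact h (hxs j g h')
    have h2 : y j g = 0 := by
      by_contra h'
      exact h (hys j g h')
    simp [h1, h2]

lemma faceCell_update_subset [DecidableEq ι] (s : ι → Option F) (j : ι) :
    faceCell (update s j none) ⊆ faceCell s := by
  rintro x ⟨hx, hs⟩
  refine ⟨hx, fun i g h => ?_⟩
  have := hs i g h
  by_cases hij : i = j
  · subst hij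
    simp at this
  · rwa [update_of_ne hij] at this

variable [DecidableEq F]

/-- The barycenter of a face. -/
noncomputable def faceBarycenter {ι F : Type*} [Fintype ι] [DecidableEq F]
    (s : ι → Option F) : ι → F → ℝ :=
  fun j g => if s j = some g then (faceRank s : ℝ)⁻¹ else 0

lemma faceBarycenter_mem {s : ι → Option F} {j : ι} (hj : s j ≠ none) :
    faceBarycenter s ∈ faceCell s := by
  have hpos : 0 < faceRank s := card_pos.2 ⟨j, by simpa [Option.isSome_iff_ne_none] using hj⟩
  refine ⟨⟨fun j g => ?_, ?_⟩, fun j g h => ?_⟩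
  · unfold faceBarycenter
    split_ifs <;> positivity
  · have h1 : ∀ j, ∑ g, faceBarycenter s j g =
        if (s j).isSome then (faceRank s : ℝ)⁻¹ else 0 := by
      intro j
      unfold faceBarycenter
      cases s j <;> simp
    simp only [h1]
    rw [← sum_filter, sum_const, nsmul_eq_mul]
    exact mul_inv_cancel₀ (by exact_mod_cast hpos.ne')
  · by_contra hne
    simp [faceBarycenter, hne] at h

/-- Translation of the colours. -/
def colourShift {ι F : Type*} [AddGroup F] (g : F) : (ι → F → ℝ) →ₗ[ℝ] (ι → F → ℝ) where
  toFun x j h := x j (-g + h)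
  map_add' _ _ := rfl
  map_smul' _ _ := rfl

lemma faceBarycenter_vadd {ι F : Type*} [Fintype ι] [DecidableEq F] [Field F] (g : F)
    (s : ι → Option F) :
    faceBarycenter (g +ᵥ s) = colourShift g (faceBarycenter s) := by
  funext j h
  have h1 : (g +ᵥ s) j = some h ↔ s j = some (-g + h) := by
    rw [pi_option_vadd_apply, Option.map_eq_some_iff]
    constructor
    · rintro ⟨a, ha, rfl⟩
      simpa using ha
    · intro h1
      exact ⟨_, h1, by simp⟩
  simp only [faceBarycenter, colourShift, faceRank_vadd, LinearMap.coe_mk, AddHom.coe_mk, h1]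

end ConfigurationSimplex

section Labels

open Finset
open scoped Pointwise

variable {κ F X : Type*} [Fintype F]

open Classical in
/-- For each index `i`, the colours at which `y i · x` is minimal, provided that it oscillates by
at least `ε`. -/
noncomputable def minLabel (y : κ → F → X → ℝ) (ε : ℝ) (x : X) (i : κ) : Finset F :=
  {g | (∃ g', y i g x + ε ≤ y i g' x) ∧ ∀ g', y i g x ≤ y i g' x}

open Classical in
/-- The union of the labels of the entries of a list. -/
noncomputable def listLabel (y : κ → F → X → ℝ) (ε : ℝ) (v : List X) (i : κ) : Finset F :=
  {g | ∃ x ∈ v, g ∈ minLabel y ε x i}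

variable {y : κ → F → X → ℝ} {ε : ℝ}

lemma mem_minLabel {x : X} {i : κ} {g : F} : g ∈ minLabel y ε x i ↔
    (∃ g', y i g x + ε ≤ y i g' x) ∧ ∀ g', y i g x ≤ y i g' x := by
  simp [minLabel]

lemma mem_listLabel {v : List X} {i : κ} {g : F} : g ∈ listLabel y ε v i ↔
    ∃ x ∈ v, g ∈ minLabel y ε x i := by
  simp [listLabel]

lemma listLabel_mono {u v : List X} (h : u ⊆ v) : listLabel y ε u ≤ listLabel y ε v := by
  intro i g hg
  rw [mem_listLabel] at hg ⊢
  obtain ⟨x, hx, hg⟩ := hg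
  exact ⟨x, h hx, hg⟩

lemma goodLabel_listLabel {v : List X} (hv : v ≠ [])
    (hosc : ∀ x ∈ v, ∃ i g g', y i g x + ε ≤ y i g' x)
    (hclose : ∀ x ∈ v, ∀ x' ∈ v, ∀ i g, y i g x < y i g x' + ε / 2) :
    GoodLabel (listLabel y ε v) := by
  constructor
  · obtain ⟨x, hx⟩ := List.exists_mem_of_ne_nil v hv
    obtain ⟨i, g, g', h⟩ := hosc x hx
    obtain ⟨a, -, ha⟩ := exists_min_image univ (fun g => y i g x) ⟨g, mem_univ g⟩
    refine ⟨i, a, mem_listLabel.2 ⟨x, hx, mem_minLabel.2 ⟨⟨g', ?_⟩, fun b => ha b (mem_univ b)⟩⟩⟩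
    linarith [ha g (mem_univ g)]
  · intro i huniv
    have hall : ∀ g, ∃ x ∈ v, g ∈ minLabel y ε x i := fun g =>
      mem_listLabel.1 (huniv ▸ mem_univ g)
    obtain ⟨x, hx⟩ := List.exists_mem_of_ne_nil v hv
    obtain ⟨-, g, -, -⟩ := hosc x hx
    obtain ⟨x, hx, hgx⟩ := hall g
    obtain ⟨⟨g', hg'⟩, -⟩ := mem_minLabel.1 hgx
    obtain ⟨x', hx', hgx'⟩ := hall g'
    linarith [(mem_minLabel.1 hgx').2 g, hclose x hx x' hx' i g', hclose x' hx' x hx i g]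

lemma listLabel_map [Field F] [DecidableEq F] {g : F} {a : X → X}
    (ha : ∀ i h x, y i h (a x) = y i (-g + h) x) (v : List X) :
    listLabel y ε (v.map a) = g +ᵥ listLabel y ε v := by
  have hmin : ∀ x i h, h ∈ minLabel y ε (a x) i ↔ -g + h ∈ minLabel y ε x i := by
    intro x i h
    simp only [mem_minLabel, ha]
    constructor
    · rintro ⟨⟨c, hc⟩, h2⟩
      exact ⟨⟨_, hc⟩, fun c => by simpa using h2 (g + c)⟩
    · rintro ⟨⟨c, hc⟩, h2⟩
      exact ⟨⟨g + c, by simpa using hc⟩, fun c => h2 _⟩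
  funext i
  ext h
  rw [Pi.vadd_apply, mem_listLabel, ← neg_vadd_mem_iff, vadd_eq_add, mem_listLabel]
  simp [hmin]

end Labels

section BalancedPoint

open Finset Function
open scoped Pointwise

lemma exists_oscillation_bound {κ F X : Type*} [Fintype κ] [Fintype F] [TopologicalSpace X]
    {P : Set X} (hP : IsCompact P) {y : κ → F → X → ℝ} (hy : ∀ i g, ContinuousOn (y i g) P)
    (hne : ∀ x ∈ P, ∃ i g g', y i g x ≠ y i g' x) :
    ∃ ε > 0, ∀ x ∈ P, ∃ i g g', y i g x + ε ≤ y i g' x := by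
  rcases P.eq_empty_or_nonempty with rfl | hPne
  · exact ⟨1, one_pos, by simp⟩
  let D : X → κ × F × F → ℝ := fun x v => y v.1 v.2.2 x - y v.1 v.2.1 x
  have hD : ContinuousOn (fun x => ‖D x‖) P :=
    (continuousOn_pi.2 fun v : κ × F × F => (hy v.1 v.2.2).sub (hy v.1 v.2.1)).norm
  obtain ⟨x₀, hx₀, hmin⟩ := hP.exists_isMinOn hPne hD
  have hpos : 0 < ‖D x₀‖ := by
    obtain ⟨i, g, g', h⟩ := hne x₀ hx₀
    refine norm_pos_iff.2 fun h0 => h ?_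
    exact (sub_eq_zero.1 (congrFun h0 (i, g, g'))).symm
  refine ⟨‖D x₀‖, hpos, fun x hx => ?_⟩
  by_contra hcon
  push Not at hcon
  have hlt : ‖D x‖ < ‖D x₀‖ := by
    refine (pi_norm_lt_iff hpos).2 fun v => ?_
    rw [Real.norm_eq_abs, abs_lt]
    constructor <;> linarith [hcon v.1 v.2.1 v.2.2, hcon v.1 v.2.2 v.2.1]
  exact absurd (hmin hx) (not_le.2 hlt)

lemma exists_uniform_modulus {κ F X : Type*} [Fintype κ] [Fintype F] [PseudoMetricSpace X]
    {P : Set X} (hP : IsCompact P) {y : κ → F → X → ℝ} (hy : ∀ i g, ContinuousOn (y i g) P)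
    {ε : ℝ} (hε : 0 < ε) :
    ∃ δ > 0, ∀ x ∈ P, ∀ x' ∈ P, dist x x' < δ → ∀ i g, y i g x < y i g x' + ε := by
  have hD : ContinuousOn (fun x (v : κ × F) => y v.1 v.2 x) P :=
    continuousOn_pi.2 fun v => hy v.1 v.2
  obtain ⟨δ, hδ, h⟩ :=
    Metric.uniformContinuousOn_iff.1 (hP.uniformContinuousOn_of_continuous hD) ε hε
  refine ⟨δ, hδ, fun x hx x' hx' hd i g => ?_⟩
  have h1 := (dist_le_pi_dist (fun v : κ × F => y v.1 v.2 x) (fun v => y v.1 v.2 x')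
    (i, g)).trans_lt (h x hx x' hx' hd)
  rw [Real.dist_eq, abs_lt] at h1
  linarith [h1.2]

variable {ι F κ β : Type*} [LinearOrder ι] [Fintype ι] [Field F] [Fintype F]

/-- Pullback of cochains along the barycentric subdivision of the faces. -/
noncomputable def facePullback (ι F : Type*) [LinearOrder ι] [Fintype ι] [Field F] [Fintype F]
    [DecidableEq F] (n : ℕ) : (List (ι → F → ℝ) → F) →ₗ[F] ((ι → Option F) → F) :=
  subdivPullback (faceCoboundary F ι F) faceBarycenter n

lemma facePullback_congr [DecidableEq F] {n : ℕ} {s : ι → Option F} {φ ψ : List (ι → F → ℝ) → F}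
    (h : ∀ l : List (ι → F → ℝ), l.length = n → (∀ x ∈ l, x ∈ faceCell s) → φ l = ψ l) :
    facePullback ι F n φ s = facePullback ι F n ψ s := by
  refine subdivPullback_congr (r := fun z s => ∃ j, s j ≠ none ∧ z = update s j none)
    (R := fun n s l => l.length = n ∧ ∀ x ∈ l, x ∈ faceCell s)
    (fun c c' s hc => faceCoboundary_congr fun j hj => hc _ ⟨j, hj, rfl⟩) (fun s => by simp) ?_
    fun l hl => h l hl.1 hl.2
  rintro n s _ l ⟨j, hj, rfl⟩ ⟨h1, h2⟩
  refine ⟨by simp [h1], fun x hx => ?_⟩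
  rcases List.mem_cons.1 hx with rfl | hx
  · exact faceBarycenter_mem hj
  · exact faceCell_update_subset s j (h2 x hx)

/-- Pullback of cochains along the labelling of the barycentric subdivision of a list. -/
noncomputable def labelPullback {X : Type*} (y : κ → F → X → ℝ) (ε : ℝ) (n : ℕ) :
    (List (κ → Finset F) → F) →ₗ[F] (List X → F) :=
  subdivPullback (listCoboundary F X) (listLabel y ε) n

lemma labelPullback_congr {X : Type*} {y : κ → F → X → ℝ} {ε : ℝ} {n : ℕ} {v : List X}
    (hgood : ∀ u : List X, u ≠ [] → u ⊆ v → GoodLabel (listLabel y ε u))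
    {φ ψ : List (κ → Finset F) → F} (h : ∀ l ∈ goodFlags κ F, l.length = n → φ l = ψ l) :
    labelPullback y ε n φ v = labelPullback y ε n ψ v := by
  refine subdivPullback_congr (r := fun z v => z.Sublist v ∧ z.length + 1 = v.length)
    (R := fun n v l => l.length = n ∧ l.Pairwise (· ≥ ·) ∧
      ∀ B ∈ l, ∃ u : List X, u ≠ [] ∧ u ⊆ v ∧ B = listLabel y ε u)
    (fun c c' y hc => listCoboundary_congr fun l h1 h2 => hc l ⟨h1, h2⟩) (fun y => by simp) ?_ ?_
  · rintro n v z l ⟨hzv, hlen⟩ ⟨h1, h2, h3⟩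
    refine ⟨by simp [h1], List.pairwise_cons.2 ⟨fun B hB => ?_, h2⟩, fun B hB => ?_⟩
    · obtain ⟨u, -, hu, rfl⟩ := h3 B hB
      exact listLabel_mono (List.Subset.trans hu hzv.subset)
    · rcases List.mem_cons.1 hB with rfl | hB
      · refine ⟨v, ?_, List.Subset.refl v, rfl⟩
        rintro rfl
        simp at hlen
      · obtain ⟨u, hu0, hu, rfl⟩ := h3 B hB
        exact ⟨u, hu0, List.Subset.trans hu hzv.subset, rfl⟩
  · rintro l ⟨h1, h2, h3⟩
    refine h l ⟨h2, fun B hB => ?_⟩ h1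
    obtain ⟨u, hu0, hu, rfl⟩ := h3 B hB
    exact hgood u hu0 hu

variable [DecidableEq F] [Fintype κ] [Fintype β] {p : ℕ} [hp : Fact p.Prime]
  [Algebra (ZMod p) F] [CharP F p]

/-- A continuous equivariant test map on the configuration complex hits the diagonal. -/
theorem exists_balanced_point (b : Module.Basis β (ZMod p) F)
    (hι : Fintype.card ι = Fintype.card κ * (Fintype.card F - 1) + 1) {V : Finset ι}
    (hV : 2 * #V ≤ Fintype.card F + 1) (y : κ → F → (ι → F → ℝ) → ℝ)
    (hy : ∀ i g, ContinuousOn (y i g) (configSimplex ι F))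
    (hyg : ∀ (g : F) i h x, y i h (colourShift g x) = y i (-g + h) x) :
    ∃ s : ι → Option F, MixedFace V Vᶜ s ∧ ∃ x ∈ faceCell s, ∀ i g g', y i g x = y i g' x := by
  by_contra hcon
  push Not at hcon
  let P : Set (ι → F → ℝ) := ⋃ s ∈ {s : ι → Option F | MixedFace V Vᶜ s}, faceCell s
  have hP : IsCompact P := (Set.toFinite _).isCompact_biUnion fun s _ => isCompact_faceCell s
  have hmemP : ∀ s : ι → Option F, MixedFace V Vᶜ s → ∀ x ∈ faceCell s, x ∈ P := fun s hs x hx =>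
    Set.mem_biUnion (x := s) hs hx
  have hyP : ∀ i g, ContinuousOn (y i g) P := fun i g =>
    (hy i g).mono (Set.iUnion₂_subset fun s _ x hx => hx.1)
  obtain ⟨ε, hε, hosc⟩ := exists_oscillation_bound hP hyP fun x hx => by
    obtain ⟨s, hs, hx⟩ := Set.mem_iUnion₂.1 hx
    exact hcon s hs x hx
  obtain ⟨δ, hδ, hclose⟩ := exists_uniform_modulus hP hyP (half_pos hε)
  set N := Fintype.card κ * (Fintype.card F - 1) with hN
  obtain ⟨m, hm⟩ := exists_pow_lt_of_lt_one hδ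
    (show (N / (N + 1) : ℝ) < 1 by rw [div_lt_one (by positivity)]; linarith)
  refine no_equivariant_cochain_map b hι hV nil_mem_goodFlags goodFlags_sublist goodFlags_vadd
    goodFlags_free (fun l => length_le_of_mem_goodFlags)
    (fun n => facePullback ι F n ∘ₗ (averagePullback (ι → F → ℝ) F n ^ m) ∘ₗ labelPullback y ε n)
    ?_ ?_ ?_ ?_
  · intro φ s
    exact averagePullback_zero_pow m (labelPullback y ε 0 φ)
  · intro n φ
    simp only [LinearMap.comp_apply]
    rw [labelPullback, subdivPullback_coboundary listCoboundary_listCoboundary,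
      averagePullback_pow_coboundary, facePullback,
      subdivPullback_coboundary faceCoboundary_faceCoboundary]
    rfl
  · intro n g φ
    simp only [LinearMap.comp_apply]
    have h1 : labelPullback y ε n (shift _ g φ) =
        fun v => labelPullback y ε n φ (v.map (colourShift g)) :=
      subdivPullback_equivariant (a := List.map (colourShift g)) (a' := (g +ᵥ ·))
        (fun v => listLabel_map (hyg g) v)
        (fun c => listCoboundary_comp_map c (colourShift g)) n φ
    rw [h1, averagePullback_pow_equivariant]
    exact subdivPullback_equivariant (a := (g +ᵥ · : (ι → Option F) → _)) (a' := colourShift g)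
      (fun s => faceBarycenter_vadd g s) (faceCoboundary_recolour (Equiv.addLeft g)) n _
  · intro n s φ φ' hs hn hφ
    simp only [LinearMap.comp_apply]
    have hnN : n ≤ N + 1 := by
      rw [← hn, ← hι]
      exact card_le_univ _
    refine facePullback_congr fun v hv hvs => averagePullback_pow_congr hnN (convex_faceCell s) m
      hvs hv (D := 1) (fun x hx x' hx' =>
        dist_le_one_of_mem_configSimplex (hvs x hx).1 (hvs x' hx').1) fun l _ hls hl =>
          labelPullback_congr (fun u hu hul => ?_) hφ
    have huP : ∀ x ∈ u, x ∈ P := fun x hx => hmemP s hs x (hls x (hul hx))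
    refine goodLabel_listLabel hu (fun x hx => hosc x (huP x hx)) fun x hx x' hx' =>
      hclose x (huP x hx) x' (huP x' hx') ?_
    exact (hl x (hul hx) x' (hul hx')).trans_lt (by rwa [mul_one])

end BalancedPoint

section ConstraintGraph

open Finset

/-- The homogeneous extension of a function on the standard simplex: at `v` it is the coordinate
sum of `v` times the value at the normalisation of `v`. -/
noncomputable def perspective {ι : Type*} [Fintype ι] (g : (ι → ℝ) → ℝ) (v : ι → ℝ) : ℝ :=
  (∑ j, v j) * g ((∑ j, v j)⁻¹ • v)

lemma continuous_perspective {ι : Type*} [Fintype ι] {g : (ι → ℝ) → ℝ} (hg : Continuous g) {C : ℝ}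
    (hC : ∀ v, |g v| ≤ C) : Continuous (perspective g) := by
  have hs : Continuous fun v : ι → ℝ => ∑ j, v j := by fun_prop
  refine continuous_iff_continuousAt.2 fun v => ?_
  by_cases hv : ∑ j, v j = 0
  · have h0 : Filter.Tendsto (fun w : ι → ℝ => |∑ j, w j| * C) (nhds v) (nhds 0) := by
      have : Continuous fun w : ι → ℝ => |∑ j, w j| * C := by fun_prop
      simpa [hv] using this.tendsto v
    have hval : perspective g v = 0 := by simp [perspective, hv]
    rw [ContinuousAt, hval]
    refine squeeze_zero_norm (fun w => ?_) h0
    rw [Real.norm_eq_abs, perspective, abs_mul]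
    exact mul_le_mul_of_nonneg_left (hC _) (abs_nonneg _)
  · exact hs.continuousAt.mul <| hg.continuousAt.comp <|
      (hs.continuousAt.inv₀ hv).smul continuousAt_id

/-- A continuous function on the standard simplex extends to a bounded continuous function. -/
lemma exists_bounded_extension {ι : Type*} [Fintype ι] (φ : C(stdSimplex ℝ ι, ℝ)) :
    ∃ g : (ι → ℝ) → ℝ, Continuous g ∧ (∃ C, ∀ v, |g v| ≤ C) ∧ ∀ w : stdSimplex ℝ ι, g w = φ w := by
  obtain ⟨g, -, hg⟩ := (BoundedContinuousFunction.mkOfCompact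
    φ).exists_norm_eq_domRestrict_eq_of_closed
    (isClosed_stdSimplex ℝ ι)
  exact ⟨g, g.continuous, ⟨‖g‖, fun v => g.norm_coe_le_norm v⟩, fun w => DFunLike.congr_fun hg w⟩

theorem exists_constrained_partition {ι F β : Type*} [LinearOrder ι] [Fintype ι] [Field F]
    [Fintype F] [DecidableEq F] [Fintype β] {p d : ℕ} [Fact p.Prime] [Algebra (ZMod p) F] [CharP F p]
    (b : Module.Basis β (ZMod p) F) (hι : Fintype.card ι = (d + 1) * (Fintype.card F - 1) + 1)
    {V : Finset ι} (hV : 2 * #V ≤ Fintype.card F + 1)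
    (f : C(stdSimplex ℝ ι, EuclideanSpace ℝ (Fin d))) :
    ∃ s : ι → Option F, MixedFace V Vᶜ s ∧ ∃ w : F → stdSimplex ℝ ι,
      (∀ g j, (w g).1 j ≠ 0 → s j = some g) ∧ ∀ g g', f (w g) = f (w g') := by
  have hf : ∀ k : Fin d, Continuous fun w => f w k := fun k => by fun_prop
  choose φ hφ hbd hφf using fun k : Fin d => exists_bounded_extension ⟨fun w => f w k, hf k⟩
  choose C hC using hbd
  let y : Option (Fin d) → F → (ι → F → ℝ) → ℝ := fun i g x =>
    i.elim (∑ j, x j g) fun k => perspective (φ k) fun j => x j g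
  have hy : ∀ i g, Continuous (y i g) := by
    rintro (_ | k) g
    · change Continuous fun x : ι → F → ℝ => ∑ j, x j g
      fun_prop
    · exact (continuous_perspective (hφ k) (hC k)).comp
        (by fun_prop : Continuous fun (x : ι → F → ℝ) j => x j g)
  obtain ⟨s, hs, x, hx, hbal⟩ := exists_balanced_point b (κ := Option (Fin d)) (by simpa using hι)
    hV y (fun i g => (hy i g).continuousOn) (fun g i h x => by cases i <;> rfl)
  have hm : ∀ g, Fintype.card F * ∑ j, x j g = 1 := fun g => by
    rw [← hx.1.2, sum_comm, ← nsmul_eq_mul, ← card_univ, ← sum_const]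
    exact sum_congr rfl fun g' _ => hbal none g g'
  have hq : (Fintype.card F : ℝ) ≠ 0 := by simp
  have hinv : ∀ g, ∑ j, x j g = (Fintype.card F : ℝ)⁻¹ := fun g =>
    eq_inv_of_mul_eq_one_right (hm g)
  let w : F → stdSimplex ℝ ι := fun g => ⟨(Fintype.card F : ℝ) • fun j => x j g,
    fun j => mul_nonneg (Nat.cast_nonneg _) (hx.1.1 j g), by
      simpa [mul_sum] using hm g⟩
  have hval : ∀ g k, y (some k) g x = (Fintype.card F : ℝ)⁻¹ * f (w g) k := fun g k => by
    change (∑ j, x j g) * φ k ((∑ j, x j g)⁻¹ • fun j => x j g) = _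
    rw [hinv, inv_inv]
    exact congrArg _ (hφf k (w g))
  refine ⟨s, hs, w, fun g j hj => hx.2 j g (right_ne_zero_of_mul hj), fun g g' => ?_⟩
  ext k
  have := hbal (some k) g g'
  rw [hval, hval] at this
  exact mul_left_cancel₀ (inv_ne_zero hq) this

end ConstraintGraph

/-- Complete graphs K_l with 2l < q + 2 are constraint graphs: for a prime
power q > 2 and N = (d+1)(q−1), given any l vertices of σ^N, every continuous
map f : ‖σ^N‖ → ℝ^d has a Tverberg partition into q pairwise disjoint faces
each of which contains at most one of the l chosen vertices. -/
theorem complete_graph_constraint (p r q d N l : ℕ)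
    (hp : p.Prime) (hr : 1 ≤ r) (hq : q = p ^ r) (hq2 : 2 < q) (hd : 1 ≤ d)
    (hN : N = (d + 1) * (q - 1)) (hl : 2 * l < q + 2)
    (V : Finset (Fin (N + 1))) (hV : V.card = l)
    (f : C(stdSimplex ℝ (Fin (N + 1)), EuclideanSpace ℝ (Fin d))) :
    ∃ F : Fin q → Finset (Fin (N + 1)),
      (Pairwise fun i j => Disjoint (F i) (F j)) ∧
      (⋂ i : Fin q, f '' faceRealization (F i)).Nonempty ∧
      (∀ i : Fin q, ((F i) ∩ V).card ≤ 1) := by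
  classical
  have : Fact p.Prime := ⟨hp⟩
  let F := GaloisField p r
  have : Fintype F := Fintype.ofFinite F
  have hcard : Fintype.card F = q := by
    rw [← Nat.card_eq_fintype_card, GaloisField.card p r (by omega), hq]
  obtain ⟨s, hs, w, hw, hfw⟩ := exists_constrained_partition (F := F) (d := d) (V := V)
    (Module.finBasis (ZMod p) F) (by rw [Fintype.card_fin, hcard, hN]) (by omega) f
  let e : Fin q ≃ F := (Fintype.equivFinOfCardEq hcard).symm
  refine ⟨fun i => Finset.univ.filter fun j => s j = some (e i), fun i i' hi => ?_,
    ⟨f (w 0), Set.mem_iInter.2 fun i => ⟨w (e i), fun j hj => ?_, hfw _ _⟩⟩, fun i => ?_⟩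
  · refine Finset.disjoint_filter.2 fun j _ h h' => hi (e.injective ?_)
    exact Option.some_injective _ (h.symm.trans h')
  · exact Finset.mem_filter.2 ⟨Finset.mem_univ j, hw _ j hj⟩
  · refine Finset.card_le_one.2 fun a ha c hc => ?_
    simp only [Finset.mem_inter, Finset.mem_filter, Finset.mem_univ, true_and] at ha hc
    exact hs.2 a ha.2 c hc.2 (e i) ha.1 hc.1
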